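/- arXiv:1312.4402 — 10 statements merged into one kernel-verified Lean document; each statement's English description precedes it below -/
import Mathlib

section
/- Let (x_n)_{n≥1} be a sequence of real numbers converging to zero, and suppose that for some real number k > 1 the limit lim_{n→∞} n^k (x_n − x_{n+1}) = l exists and is a finite real number. Then lim_{n→∞} n^{k−1} x_n = l/(k−1). -/
open Filter Topology

/-- An eventually nondecreasing sequence is eventually bounded above by its limit. -/
theorem eventually_le_of_tendsto_of_eventually_le_succ {u : ℕ → ℝ} {a : ℝ}
    (hu : Tendsto u atTop (𝓝 a)) (h : ∀ᶠ n in atTop, u n ≤ u (n + 1)) :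
    ∀ᶠ n in atTop, u n ≤ a := by
  obtain ⟨N, hN⟩ := eventually_atTop.1 h
  have hmono : Monotone fun m => u (m + N) := monotone_nat_of_le_succ fun m => by
    have := hN (m + N) (by omega)
    rwa [show m + 1 + N = m + N + 1 by omega]
  filter_upwards [eventually_ge_atTop N] with n hn
  have := hmono.ge_of_tendsto ((tendsto_add_atTop_iff_nat N).2 hu) (n - N)
  simpa [Nat.sub_add_cancel hn] using this

/-- The Cesàro–Stolz theorem in the `0 / 0` case. -/
theorem tendsto_div_of_tendsto_sub_succ_div {a b : ℕ → ℝ} {L : ℝ}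
    (ha : Tendsto a atTop (𝓝 0)) (hb : Tendsto b atTop (𝓝 0))
    (hpos : ∀ᶠ n in atTop, 0 < b n) (hlt : ∀ᶠ n in atTop, b (n + 1) < b n)
    (h : Tendsto (fun n => (a n - a (n + 1)) / (b n - b (n + 1))) atTop (𝓝 L)) :
    Tendsto (fun n => a n / b n) atTop (𝓝 L) := by
  rw [Metric.tendsto_nhds] at h ⊢
  intro ε hε
  have hstep : ∀ᶠ n in atTop,
      |(a n - a (n + 1)) - L * (b n - b (n + 1))| ≤ ε / 2 * (b n - b (n + 1)) := by
    filter_upwards [h (ε / 2) (half_pos hε), hlt] with n hn hn'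
    have hd : 0 < b n - b (n + 1) := sub_pos.2 hn'
    rw [Real.dist_eq, div_sub' hd.ne', abs_div, abs_of_pos hd, div_lt_iff₀ hd] at hn
    rw [mul_comm L]
    exact hn.le
  have hlim (c : ℝ) : Tendsto (fun n => a n - c * b n) atTop (𝓝 0) := by
    simpa using ha.sub (hb.const_mul c)
  have hupper := eventually_le_of_tendsto_of_eventually_le_succ
    (by simpa using (hlim (L - ε / 2)).neg) (u := fun n => -(a n - (L - ε / 2) * b n)) (a := 0) <| by
      filter_upwards [hstep] with n hn
      linarith [(abs_le.1 hn).1]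
  have hlower := eventually_le_of_tendsto_of_eventually_le_succ (hlim (L + ε / 2)) <| by
    filter_upwards [hstep] with n hn
    linarith [(abs_le.1 hn).2]
  filter_upwards [hupper, hlower, hpos] with n h₁ h₂ hn
  have := mul_pos hε hn
  rw [Real.dist_eq, div_sub' hn.ne', abs_div, abs_of_pos hn, div_lt_iff₀ hn, abs_lt]
  constructor <;> linarith

theorem tendsto_rpow_mul_rpow_neg_sub_succ (p : ℝ) :
    Tendsto (fun n : ℕ => (n : ℝ) ^ (p + 1) * ((n : ℝ) ^ (-p) - ((n + 1 : ℕ) : ℝ) ^ (-p)))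
      atTop (𝓝 p) := by
  have hderiv : HasDerivAt (fun t : ℝ => t ^ (-p)) (-p) 1 := by
    simpa using Real.hasDerivAt_rpow_const (x := 1) (p := -p) (Or.inl one_ne_zero)
  have hinv : Tendsto (fun n : ℕ => ((n : ℝ))⁻¹) atTop (𝓝[≠] 0) := by
    refine tendsto_nhdsWithin_iff.2 ⟨tendsto_inv_atTop_nhds_zero_nat, ?_⟩
    filter_upwards [eventually_gt_atTop 0] with n hn
    simpa using hn.ne'
  have hlim := (hderiv.tendsto_slope_zero.comp hinv).neg
  rw [neg_neg] at hlim
  refine hlim.congr' ?_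
  filter_upwards [eventually_gt_atTop 0] with n hn
  have hn' : (0 : ℝ) < n := by exact_mod_cast hn
  have hsucc : ((n + 1 : ℕ) : ℝ) = n * (1 + (n : ℝ)⁻¹) := by
    push_cast
    field_simp
  have hcancel : (n : ℝ) ^ p * (n : ℝ) ^ (-p) = 1 := by
    rw [← Real.rpow_add hn', add_neg_cancel, Real.rpow_zero]
  rw [hsucc, Real.mul_rpow hn'.le (by positivity), Real.rpow_add_one hn'.ne']
  simp only [Function.comp_apply, inv_inv, smul_eq_mul, Real.one_rpow]
  linear_combination (-(n : ℝ) * (1 - (1 + (n : ℝ)⁻¹) ^ (-p))) * hcancel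

/-- Cesàro–Stolz type lemma (Lemma 2.1): if `x n → 0` and
`n^k * (x n - x (n+1)) → l` (finite) for some `k > 1`, then
`n^(k-1) * x n → l / (k-1)`. -/
theorem cesaro_stolz_rate_finite (x : ℕ → ℝ) (k l : ℝ) (hk : 1 < k)
    (hx : Tendsto x atTop (𝓝 0))
    (hl : Tendsto (fun n : ℕ => (n : ℝ) ^ k * (x n - x (n + 1))) atTop (𝓝 l)) :
    Tendsto (fun n : ℕ => (n : ℝ) ^ (k - 1) * x n) atTop (𝓝 (l / (k - 1))) := by
  have hp : 0 < k - 1 := sub_pos.2 hk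
  have hdiff := tendsto_rpow_mul_rpow_neg_sub_succ (k - 1)
  rw [sub_add_cancel] at hdiff
  have hb : Tendsto (fun n : ℕ => (n : ℝ) ^ (-(k - 1))) atTop (𝓝 0) :=
    (tendsto_rpow_neg_atTop hp).comp tendsto_natCast_atTop_atTop
  have hquot := tendsto_div_of_tendsto_sub_succ_div (L := l / (k - 1)) hx hb
    (by
      filter_upwards [eventually_gt_atTop 0] with n hn
      positivity)
    (by
      filter_upwards [eventually_gt_atTop 0] with n hn
      exact Real.rpow_lt_rpow_of_neg (by exact_mod_cast hn) (by simp) (neg_lt_zero.2 hp))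
    (by
      refine (hl.div hdiff hp.ne').congr' ?_
      filter_upwards [eventually_gt_atTop 0] with n hn
      exact mul_div_mul_left _ _ (by positivity))
  refine hquot.congr fun n => ?_
  rw [Real.rpow_neg n.cast_nonneg, div_inv_eq_mul, mul_comm]
end

section
/- Let (x_n)_{n≥1} be a sequence of real numbers converging to zero, and suppose that for some real number k > 1 one has lim_{n→∞} n^k (x_n − x_{n+1}) = +∞ (in the sense of tending to infinity). Then lim_{n→∞} n^{k−1} x_n = +∞. -/
open Filter Topology

/-- Tangent line bound for the convex function `t ↦ t ^ (-p)` on the positive reals. -/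
theorem rpow_neg_sub_rpow_neg_add_one_le {p t : ℝ} (hp : 0 ≤ p) (ht : 0 < t) :
    t ^ (-p) - (t + 1) ^ (-p) ≤ p * t ^ (-(p + 1)) := by
  have hs : 0 < 1 + t⁻¹ := by positivity
  have hlog : Real.log (1 + t⁻¹) ≤ t⁻¹ := by
    linarith [Real.log_le_sub_one_of_pos hs]
  have hbern : 1 - p * t⁻¹ ≤ (1 + t⁻¹) ^ (-p) := by
    rw [Real.rpow_def_of_pos hs]
    nlinarith [Real.add_one_le_exp (Real.log (1 + t⁻¹) * -p),
      mul_le_mul_of_nonneg_left hlog hp]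
  have hsplit : (t + 1) ^ (-p) = t ^ (-p) * (1 + t⁻¹) ^ (-p) := by
    rw [← Real.mul_rpow ht.le hs.le]
    congr 1
    field_simp
  have hpow : t ^ (-(p + 1)) = t ^ (-p) * t⁻¹ := by
    rw [neg_add, Real.rpow_add ht, Real.rpow_neg_one]
  rw [hsplit, hpow]
  linarith [mul_le_mul_of_nonneg_left hbern (Real.rpow_nonneg ht.le (-p))]

/-- Cesàro–Stolz type lemma (Lemma 2.1, infinite case): if `x n → 0` and
`n^k * (x n - x (n+1)) → +∞` for some `k > 1`, then `n^(k-1) * x n → +∞`. -/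
theorem cesaro_stolz_rate_infinite (x : ℕ → ℝ) (k : ℝ) (hk : 1 < k)
    (hx : Tendsto x atTop (𝓝 0))
    (hl : Tendsto (fun n : ℕ => (n : ℝ) ^ k * (x n - x (n + 1))) atTop atTop) :
    Tendsto (fun n : ℕ => (n : ℝ) ^ (k - 1) * x n) atTop atTop := by
  obtain ⟨p, rfl⟩ : ∃ p, k = p + 1 := ⟨k - 1, by ring⟩
  have hp : 0 < p := by linarith
  simp only [add_sub_cancel_right]
  rw [tendsto_atTop]
  intro b
  set D : ℝ := max b 0
  obtain ⟨N, hN⟩ := eventually_atTop.1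
    ((tendsto_atTop.1 hl (p * D)).and (eventually_gt_atTop 0))
  have hstep : ∀ n ≥ N, D * ((n : ℝ) ^ (-p) - ((n : ℝ) + 1) ^ (-p)) ≤ x n - x (n + 1) := by
    intro n hn
    obtain ⟨hDn, hn0⟩ := hN n hn
    have hn0 : (0 : ℝ) < n := by exact_mod_cast hn0
    calc D * ((n : ℝ) ^ (-p) - ((n : ℝ) + 1) ^ (-p))
        ≤ D * (p * (n : ℝ) ^ (-(p + 1))) :=
          mul_le_mul_of_nonneg_left (rpow_neg_sub_rpow_neg_add_one_le hp.le hn0)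
            (le_max_right b 0)
      _ = p * D / (n : ℝ) ^ (p + 1) := by rw [Real.rpow_neg hn0.le]; ring
      _ ≤ x n - x (n + 1) := by
          rw [div_le_iff₀' (Real.rpow_pos_of_pos hn0 _)]
          exact hDn
  have hanti : Antitone fun m : ℕ => x (m + N) - D * ((m + N : ℕ) : ℝ) ^ (-p) := by
    refine antitone_nat_of_succ_le fun m => ?_
    have h := hstep (m + N) (Nat.le_add_left N m)
    rw [Nat.add_right_comm m 1 N, Nat.cast_succ]
    linarith
  have hlim : Tendsto (fun m : ℕ => x (m + N) - D * ((m + N : ℕ) : ℝ) ^ (-p)) atTop (𝓝 0) := by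
    have h := hx.sub (((tendsto_rpow_neg_atTop hp).comp
      (tendsto_natCast_atTop_atTop (R := ℝ))).const_mul D)
    rw [mul_zero, sub_zero] at h
    exact h.comp (tendsto_add_atTop_nat N)
  filter_upwards [eventually_ge_atTop N] with n hn
  have hn0 : (0 : ℝ) < n := by exact_mod_cast (hN n hn).2
  have h := hanti.le_of_tendsto hlim (n - N)
  rw [Nat.sub_add_cancel hn, sub_nonneg, Real.rpow_neg hn0.le, ← div_eq_mul_inv,
    div_le_iff₀' (Real.rpow_pos_of_pos hn0 _)] at h
  exact (le_max_left b 0).trans h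
end

section
/- For real parameters a and b, define z_n = ln(n!) − ln(√(2π)) − (1/2)·ln n − n·ln(n/e + a/n + b/n³) for n ≥ 1 (for n large enough that n/e + a/n + b/n³ > 0). Then lim_{n→∞} n²·(z_n − z_{n+1}) = 1/12 − a·e. -/
open Filter Topology Real

lemma abs_log_one_add_sub_le {u : ℝ} (hu : |u| ≤ 1 / 2) :
    |Real.log (1 + u) - u| ≤ 2 * u ^ 2 := by
  have h := Real.abs_log_sub_add_sum_range_le (x := -u) (by rw [abs_neg]; linarith) 1
  simp only [Finset.sum_range_one, abs_neg, sub_neg_eq_add] at h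
  norm_num at h
  rw [show Real.log (1 + u) - u = -u + Real.log (1 + u) by ring]
  refine h.trans ?_
  rw [div_le_iff₀ (by linarith)]
  nlinarith [sq_nonneg u]

lemma abs_log_one_add_sub_cubic_le {u : ℝ} (hu : |u| ≤ 1 / 2) :
    |Real.log (1 + u) - (u - u ^ 2 / 2 + u ^ 3 / 3)| ≤ 2 * u ^ 4 := by
  have h := Real.abs_log_sub_add_sum_range_le (x := -u) (by rw [abs_neg]; linarith) 3
  simp only [Finset.sum_range_succ, Finset.sum_range_zero, abs_neg, sub_neg_eq_add] at h
  norm_num at h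
  rw [show Real.log (1 + u) - (u - u ^ 2 / 2 + u ^ 3 / 3)
    = -u + (-u) ^ 2 / 2 + (-u) ^ 3 / 3 + Real.log (1 + u) by ring]
  rw [show (-u) ^ 2 = u ^ 2 by ring]
  have h4 : |u| ^ 4 = u ^ 4 := by rw [← abs_pow, abs_of_nonneg (by positivity)]
  rw [h4] at h
  refine h.trans ?_
  rw [div_le_iff₀ (by linarith)]
  nlinarith [show 0 ≤ u ^ 4 by positivity]

lemma tendsto_sq_mul_log_one_add_inv :
    Tendsto (fun x : ℝ => x ^ 2 * ((x + 1 / 2) * Real.log (1 + 1 / x) - 1)) atTop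
      (𝓝 (1 / 12)) := by
  rw [tendsto_iff_norm_sub_tendsto_zero]
  have hlim : Tendsto (fun x : ℝ => 5 * x⁻¹) atTop (𝓝 0) := by
    simpa using tendsto_inv_atTop_zero.const_mul (5 : ℝ)
  refine squeeze_zero' (Eventually.of_forall fun _ => norm_nonneg _) ?_ hlim
  filter_upwards [eventually_ge_atTop (2 : ℝ)] with x hx
  have hx0 : 0 < x := by linarith
  have hb : |1 / x| ≤ 1 / 2 := by
    rw [abs_of_pos (by positivity)]
    exact one_div_le_one_div_of_le (by norm_num) hx
  have h := abs_log_one_add_sub_cubic_le hb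
  set ρ := Real.log (1 + 1 / x) - (1 / x - (1 / x) ^ 2 / 2 + (1 / x) ^ 3 / 3) with hρ
  have hlog : Real.log (1 + 1 / x) = 1 / x - (1 / x) ^ 2 / 2 + (1 / x) ^ 3 / 3 + ρ := by
    rw [hρ]; ring
  have key : x ^ 2 * ((x + 1 / 2) * Real.log (1 + 1 / x) - 1) - 1 / 12
      = 1 / 6 * x⁻¹ + x ^ 2 * (x + 1 / 2) * ρ := by
    rw [hlog]; field_simp; ring
  rw [key, Real.norm_eq_abs]
  refine (abs_add_le _ _).trans ?_
  rw [abs_mul (x ^ 2 * (x + 1 / 2)), abs_of_pos (show 0 < 1 / 6 * x⁻¹ by positivity),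
    abs_of_pos (show 0 < x ^ 2 * (x + 1 / 2) by positivity)]
  calc 1 / 6 * x⁻¹ + x ^ 2 * (x + 1 / 2) * |ρ|
      ≤ 1 / 6 * x⁻¹ + x ^ 2 * (x + x) * (2 * (1 / x) ^ 4) := by gcongr; linarith
    _ = (1 / 6 + 4) * x⁻¹ := by field_simp; ring
    _ ≤ 5 * x⁻¹ := by gcongr; norm_num

lemma tendsto_sq_mul_log_remainder (A B : ℝ) :
    Tendsto (fun x : ℝ => x ^ 2 * (x * Real.log (1 + (A / x ^ 2 + B / x ^ 4)) - A / x)) atTop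
      (𝓝 0) := by
  set K := |A| + |B| with hK
  have hK0 : 0 ≤ K := by positivity
  have hlim : Tendsto (fun x : ℝ => (2 * K ^ 2 + |B|) * x⁻¹) atTop (𝓝 0) := by
    have h := (tendsto_inv_atTop_zero (𝕜 := ℝ)).const_mul (2 * K ^ 2 + |B|)
    rwa [mul_zero] at h
  refine squeeze_zero_norm' ?_ hlim
  filter_upwards [eventually_ge_atTop (1 + 2 * K)] with x hx
  have hx1 : 1 ≤ x := by linarith
  have hx0 : 0 < x := by linarith
  have hu : |A / x ^ 2 + B / x ^ 4| ≤ K / x ^ 2 := by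
    refine (abs_add_le _ _).trans ?_
    rw [abs_div, abs_div, abs_of_pos (show 0 < x ^ 2 by positivity),
      abs_of_pos (show 0 < x ^ 4 by positivity), hK, add_div]
    gcongr
    norm_num
  have hu2 : |A / x ^ 2 + B / x ^ 4| ≤ 1 / 2 := by
    refine hu.trans ?_
    rw [div_le_iff₀ (by positivity)]
    nlinarith
  have h := abs_log_one_add_sub_le hu2
  have hsq : (A / x ^ 2 + B / x ^ 4) ^ 2 ≤ (K / x ^ 2) ^ 2 := by
    rw [← sq_abs]; gcongr
  have key : x ^ 2 * (x * Real.log (1 + (A / x ^ 2 + B / x ^ 4)) - A / x)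
      = x ^ 3 * (Real.log (1 + (A / x ^ 2 + B / x ^ 4)) - (A / x ^ 2 + B / x ^ 4))
        + B * x⁻¹ := by
    field_simp; ring
  rw [key, Real.norm_eq_abs]
  refine (abs_add_le _ _).trans ?_
  rw [abs_mul, abs_mul B, abs_of_pos (show 0 < x ^ 3 by positivity),
    abs_of_pos (show 0 < x⁻¹ by positivity)]
  calc _ ≤ x ^ 3 * (2 * (K / x ^ 2) ^ 2) + |B| * x⁻¹ := by
        gcongr
        exact h.trans (by gcongr)
    _ = (2 * K ^ 2 + |B|) * x⁻¹ := by field_simp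

lemma tendsto_div_add_one_atTop : Tendsto (fun x : ℝ => x / (x + 1)) atTop (𝓝 1) := by
  have h : Tendsto (fun x : ℝ => 1 - (x + 1)⁻¹) atTop (𝓝 (1 - 0)) :=
    (tendsto_inv_atTop_zero.comp (tendsto_atTop_add_const_right _ 1 tendsto_id)).const_sub 1
  rw [sub_zero] at h
  refine h.congr' ?_
  filter_upwards [eventually_gt_atTop (0 : ℝ)] with x hx
  field_simp
  ring

lemma tendsto_sq_mul_log_sub (A B : ℝ) :
    Tendsto (fun x : ℝ => x ^ 2 *
      ((x + 1) * Real.log (1 + (A / (x + 1) ^ 2 + B / (x + 1) ^ 4))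
        - x * Real.log (1 + (A / x ^ 2 + B / x ^ 4)))) atTop (𝓝 (-A)) := by
  have h0 := tendsto_sq_mul_log_remainder A B
  have h1 := h0.comp (tendsto_atTop_add_const_right _ (1 : ℝ) tendsto_id)
  have hd := tendsto_div_add_one_atTop
  have h := (((hd.pow 2).mul h1).sub h0).sub (hd.const_mul A)
  simp only [mul_zero, sub_zero, mul_one, zero_sub] at h
  refine h.congr' ?_
  filter_upwards [eventually_gt_atTop (0 : ℝ)] with x hx
  simp only [Function.comp, id]
  field_simp
  ring

/-- For large `x` the logarithm of the corrected base splits off `log (x / e)`. -/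
lemma log_corrected_base_eventually (a b : ℝ) :
    ∀ᶠ x : ℝ in atTop, Real.log (x / Real.exp 1 + a / x + b / x ^ 3)
      = Real.log x - 1
        + Real.log (1 + (a * Real.exp 1 / x ^ 2 + b * Real.exp 1 / x ^ 4)) := by
  have hlim : Tendsto (fun x : ℝ => 1 + (a * Real.exp 1 / x ^ 2 + b * Real.exp 1 / x ^ 4))
      atTop (𝓝 (1 + (0 + 0))) :=
    ((tendsto_const_nhds.div_atTop (tendsto_pow_atTop two_ne_zero)).add
      (tendsto_const_nhds.div_atTop (tendsto_pow_atTop four_ne_zero))).const_add 1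
  filter_upwards [eventually_gt_atTop (0 : ℝ),
    hlim.eventually_ne (show (1 + (0 + 0) : ℝ) ≠ 0 by norm_num)] with x hx hne
  have he := Real.exp_pos 1
  rw [show x / Real.exp 1 + a / x + b / x ^ 3
      = x / Real.exp 1 * (1 + (a * Real.exp 1 / x ^ 2 + b * Real.exp 1 / x ^ 4)) by
    field_simp; ring, Real.log_mul (by positivity) hne, Real.log_div hx.ne' he.ne', Real.log_exp]

/-- Expansion (3), leading coefficient: for the logarithmic error `z n` of the
approximation `n! ≈ √(2πn) (n/e + a/n + b/n³)ⁿ`, one has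
`n² (z n - z (n+1)) → 1/12 - a e`. -/
theorem tendsto_sq_mul_z_sub (a b : ℝ)
    (z : ℕ → ℝ)
    (hz : ∀ n : ℕ, 1 ≤ n →
      z n = Real.log (Nat.factorial n) - Real.log (Real.sqrt (2 * π))
        - (1 / 2) * Real.log n
        - n * Real.log ((n : ℝ) / Real.exp 1 + a / n + b / (n : ℝ) ^ 3)) :
    Tendsto (fun n : ℕ => (n : ℝ) ^ 2 * (z n - z (n + 1))) atTop
      (𝓝 (1 / 12 - a * Real.exp 1)) := by
  have hcast : Tendsto (fun n : ℕ => (n : ℝ)) atTop atTop := tendsto_natCast_atTop_atTop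
  have h := (tendsto_sq_mul_log_one_add_inv.add
    (tendsto_sq_mul_log_sub (a * Real.exp 1) (b * Real.exp 1))).comp hcast
  rw [← sub_eq_add_neg] at h
  refine h.congr' ?_
  have hlog := hcast.eventually (log_corrected_base_eventually a b)
  filter_upwards [eventually_ge_atTop 1, hlog, (tendsto_add_atTop_nat 1).eventually hlog]
    with n hn hl hl'
  have hn0 : (0 : ℝ) < n := by exact_mod_cast hn
  rw [hz n hn, hz (n + 1) (by omega), hl, hl', Nat.factorial_succ]
  simp only [Function.comp]
  push_cast
  rw [Real.log_mul (by positivity) (by positivity),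
    show (1 : ℝ) + 1 / n = (n + 1) / n by field_simp,
    Real.log_div (by positivity) hn0.ne']
  ring
end

section
/- For real parameters a and b with a ≠ 1/(12e), define z_n = ln(n!) − ln(√(2π)) − (1/2)·ln n − n·ln(n/e + a/n + b/n³) for n ≥ 1 (for n large enough that n/e + a/n + b/n³ > 0). Then lim_{n→∞} n·z_n = 1/12 − a·e, which is nonzero; in particular the rate of convergence of (z_n) to zero is n^{−1}. -/
open Filter Topology Real

open Stirling in
/-- Lower bound for the decrements of `log (stirlingSeq n)`. -/
lemma le_log_stirlingSeq_sub (n : ℕ) :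
    1 / (12 * (n + 1 : ℝ) + 6) - 1 / (12 * (n + 2 : ℝ) + 6) ≤
      log (stirlingSeq (n + 1)) - log (stirlingSeq (n + 2)) := by
  have h := le_hasSum (log_stirlingSeq_sdiff_hasSum n) 0 fun k _ ↦ by positivity
  refine le_trans ?_ h
  have hn : (0 : ℝ) ≤ n := n.cast_nonneg
  rw [div_sub_div _ _ (by positivity) (by positivity)]
  simp only [zero_add, Nat.cast_one, pow_one, Nat.cast_add]
  rw [div_pow, div_mul_div_comm, div_le_div_iff₀ (by positivity) (by positivity)]
  nlinarith [mul_nonneg hn hn]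

lemma tendsto_one_div_twelve_mul_add (c : ℝ) :
    Tendsto (fun n : ℕ ↦ 1 / (12 * (n + 1 : ℝ) + c)) atTop (𝓝 0) := by
  refine tendsto_const_nhds.div_atTop (tendsto_atTop_add_const_right _ _ ?_)
  exact (tendsto_atTop_add_const_right _ _ tendsto_natCast_atTop_atTop).const_mul_atTop
    (by norm_num)

lemma tendsto_log_stirlingSeq_succ :
    Tendsto (fun n : ℕ ↦ log (Stirling.stirlingSeq (n + 1))) atTop (𝓝 (log √π)) :=
  ((tendsto_add_atTop_iff_nat 1).2 Stirling.tendsto_stirlingSeq_sqrt_pi).log (by positivity)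

open Stirling in
lemma log_stirlingSeq_succ_le (n : ℕ) :
    log (stirlingSeq (n + 1)) - log √π ≤ 1 / (12 * (n + 1 : ℝ)) := by
  have hm : Monotone fun n : ℕ ↦ log (stirlingSeq (n + 1)) - 1 / (12 * (n + 1 : ℝ) + 0) := by
    refine monotone_nat_of_le_succ fun k ↦ ?_
    have h := log_stirlingSeq_sdiff_le (k + 1)
    have e : 1 / (12 * ((k + 1 : ℕ) : ℝ) * (((k + 1 : ℕ) : ℝ) + 1)) =
        1 / (12 * (k + 1 : ℝ) + 0) - 1 / (12 * (((k + 1 : ℕ) : ℝ) + 1) + 0) := by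
      push_cast
      field_simp
      ring
    linarith
  have h := hm.ge_of_tendsto (tendsto_log_stirlingSeq_succ.sub (tendsto_one_div_twelve_mul_add 0)) n
  simp only [add_zero, sub_zero] at h
  linarith

open Stirling in
lemma le_log_stirlingSeq_succ (n : ℕ) :
    1 / (12 * (n + 1 : ℝ) + 6) ≤ log (stirlingSeq (n + 1)) - log √π := by
  have hm : Antitone fun n : ℕ ↦ log (stirlingSeq (n + 1)) - 1 / (12 * (n + 1 : ℝ) + 6) := by
    refine antitone_nat_of_succ_le fun k ↦ ?_
    have h := le_log_stirlingSeq_sub k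
    have e : ((k + 1 : ℕ) : ℝ) + 1 = k + 2 := by push_cast; ring
    rw [e]
    linarith
  have h := hm.le_of_tendsto (tendsto_log_stirlingSeq_succ.sub (tendsto_one_div_twelve_mul_add 6)) n
  simp only [sub_zero] at h
  linarith

/-- The first correction term of Stirling's series. -/
lemma tendsto_mul_log_stirlingSeq_sub :
    Tendsto (fun n : ℕ ↦ (n : ℝ) * (log (Stirling.stirlingSeq n) - log √π)) atTop
      (𝓝 (1 / 12)) := by
  rw [← tendsto_add_atTop_iff_nat 1]
  have hl : Tendsto (fun n : ℕ ↦ 1 / 12 - 1 / 2 * (1 / (12 * (n + 1 : ℝ) + 6))) atTop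
      (𝓝 (1 / 12)) := by
    simpa using ((tendsto_one_div_twelve_mul_add 6).const_mul (1 / 2 : ℝ)).const_sub (1 / 12 : ℝ)
  refine tendsto_of_tendsto_of_tendsto_of_le_of_le hl tendsto_const_nhds (fun n ↦ ?_) fun n ↦ ?_
  · have h := mul_le_mul_of_nonneg_left (le_log_stirlingSeq_succ n)
      (by positivity : 0 ≤ (n + 1 : ℝ))
    have e : 1 / 12 - 1 / 2 * (1 / (12 * (n + 1 : ℝ) + 6)) =
        (n + 1 : ℝ) * (1 / (12 * (n + 1 : ℝ) + 6)) := by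
      field_simp
      ring
    push_cast
    exact e.trans_le h
  · have h := mul_le_mul_of_nonneg_left (log_stirlingSeq_succ_le n)
      (by positivity : 0 ≤ (n + 1 : ℝ))
    have e : (n + 1 : ℝ) * (1 / (12 * (n + 1 : ℝ))) = 1 / 12 := by
      field_simp
    push_cast
    exact h.trans_eq e

/-- Theorem 2.1 (i): if `a ≠ 1/(12e)`, then `n * z n → 1/12 - a e ≠ 0`,
so the rate of convergence of `z n` to zero is `n⁻¹`. -/
theorem tendsto_n_mul_z (a b : ℝ) (ha : a ≠ 1 / (12 * Real.exp 1))
    (z : ℕ → ℝ)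
    (hz : ∀ n : ℕ, 1 ≤ n →
      z n = Real.log (Nat.factorial n) - Real.log (Real.sqrt (2 * π))
        - (1 / 2) * Real.log n
        - n * Real.log ((n : ℝ) / Real.exp 1 + a / n + b / (n : ℝ) ^ 3)) :
    Tendsto (fun n : ℕ => (n : ℝ) * z n) atTop (𝓝 (1 / 12 - a * Real.exp 1)) ∧
      1 / 12 - a * Real.exp 1 ≠ 0 := by
  refine ⟨?_, fun h ↦ ha ?_⟩
  swap
  · rw [eq_div_iff (by positivity)]
    linarith
  have hsq : Tendsto (fun n : ℕ ↦ (n : ℝ) ^ 2) atTop atTop :=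
    (tendsto_pow_atTop two_ne_zero).comp tendsto_natCast_atTop_atTop
  let g : ℝ → ℝ := fun x ↦ a * exp 1 / x + b * exp 1 / x ^ 2
  have hg : Tendsto (fun x ↦ x * g x) atTop (𝓝 (a * exp 1)) := by
    have h : Tendsto (fun x : ℝ ↦ a * exp 1 + b * exp 1 / x) atTop (𝓝 (a * exp 1)) := by
      simpa using (tendsto_const_nhds (x := b * exp 1)).div_atTop tendsto_id
        |>.const_add (a * exp 1)
    refine h.congr' ?_
    filter_upwards [eventually_gt_atTop 0] with x hx
    simp only [g]
    field_simp
  have hlog : Tendsto (fun n : ℕ ↦ (n : ℝ) ^ 2 * log (1 + g ((n : ℝ) ^ 2))) atTop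
      (𝓝 (a * exp 1)) := (Real.tendsto_mul_log_one_add_of_tendsto hg).comp hsq
  have hg0 : Tendsto (fun n : ℕ ↦ g ((n : ℝ) ^ 2)) atTop (𝓝 0) := by
    have h : Tendsto g atTop (𝓝 (0 + 0)) :=
      (tendsto_const_nhds.div_atTop tendsto_id).add
        (tendsto_const_nhds.div_atTop (tendsto_pow_atTop two_ne_zero))
    rw [add_zero] at h
    exact h.comp hsq
  refine (tendsto_mul_log_stirlingSeq_sub.sub hlog).congr' ?_
  filter_upwards [eventually_ge_atTop 1,
    hg0.eventually (lt_mem_nhds (show (-1 : ℝ) < 0 by norm_num))] with n hn hgn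
  have hn0 : (0 : ℝ) < n := by exact_mod_cast hn
  have e : (n : ℝ) / exp 1 + a / n + b / (n : ℝ) ^ 3 = n / exp 1 * (1 + g ((n : ℝ) ^ 2)) := by
    simp only [g]
    field_simp
    ring
  rw [hz n hn, e, log_mul (by positivity) (by linarith), Stirling.log_stirlingSeq_formula,
    log_sqrt (by positivity), log_sqrt (by positivity), log_mul two_ne_zero (by positivity),
    log_mul two_ne_zero (by positivity)]
  ring
end

section
/- For the real parameter b, set a = 1/(12e) and define z_n = ln(n!) − ln(√(2π)) − (1/2)·ln n − n·ln(n/e + a/n + b/n³) for n ≥ 1. Then lim_{n→∞} n⁴·(z_n − z_{n+1}) = 1/480 − 3·b·e. -/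
open Filter Topology Real

open Asymptotics in
/-- The Taylor polynomials of `log (1 - x)` at `0`, with remainder. -/
theorem log_one_sub_add_sum_isBigO (n : ℕ) :
    (fun x : ℝ => (∑ i ∈ Finset.range n, x ^ (i + 1) / (i + 1)) + Real.log (1 - x))
      =O[𝓝 0] fun x => x ^ (n + 1) := by
  refine IsBigO.of_bound 2 ?_
  filter_upwards [Metric.ball_mem_nhds (0 : ℝ) (show (0 : ℝ) < 1 / 2 by norm_num)] with x hx
  rw [Metric.mem_ball, dist_zero_right, norm_eq_abs] at hx
  rw [norm_eq_abs, norm_eq_abs, abs_pow]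
  refine (abs_log_sub_add_sum_range_le (by linarith) n).trans ?_
  rw [div_le_iff₀ (by linarith)]
  nlinarith [pow_nonneg (abs_nonneg x) (n + 1)]

/-- The quintic Taylor expansion of `log (1 + x)` at `0`. -/
theorem tendsto_log_one_add_sub_taylor_div_pow_five :
    Tendsto (fun x : ℝ => (Real.log (1 + x) - (x - x ^ 2 / 2 + x ^ 3 / 3 - x ^ 4 / 4 + x ^ 5 / 5))
      / x ^ 5) (𝓝 0) (𝓝 0) := by
  have hneg : Tendsto (fun x : ℝ => -x) (𝓝 0) (𝓝 0) := by
    simpa using (continuous_neg.tendsto (0 : ℝ))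
  have h := (((log_one_sub_add_sum_isBigO 5).comp_tendsto hneg).congr_right
    (g₂ := fun x : ℝ => x ^ 6) fun x => by simp only [Function.comp]; ring).trans_isLittleO
      (Asymptotics.isLittleO_pow_pow (show 5 < 6 by norm_num))
  refine h.tendsto_div_nhds_zero.congr fun x => ?_
  simp only [Function.comp, Finset.sum_range_succ, Finset.sum_range_zero, sub_neg_eq_add]
  push_cast
  ring

/-- The quartic Taylor expansion of `log (1 + x² / 12 + c x⁴)` at `0`. -/
theorem tendsto_log_even_quartic_sub_taylor_div_pow_five (c : ℝ) :
    Tendsto (fun x : ℝ => (Real.log (1 + x ^ 2 / 12 + c * x ^ 4)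
      - (x ^ 2 / 12 + (c - 1 / 288) * x ^ 4)) / x ^ 5) (𝓝 0) (𝓝 0) := by
  have hq : Tendsto (fun x : ℝ => -(x ^ 2 / 12 + c * x ^ 4)) (𝓝 0) (𝓝 0) := by
    have : Continuous fun x : ℝ => -(x ^ 2 / 12 + c * x ^ 4) := by fun_prop
    simpa using this.tendsto 0
  have hbd : (fun x : ℝ => (1 / 12 + c * x ^ 2)) =O[𝓝 0] fun _ => (1 : ℝ) :=
    (show Continuous fun x : ℝ => (1 / 12 + c * x ^ 2) by fun_prop).continuousAt.isBigO_one ℝ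
  have hbd' : (fun x : ℝ => (c / 12 + c ^ 2 * x ^ 2 / 2)) =O[𝓝 0] fun _ => (1 : ℝ) :=
    (show Continuous fun x : ℝ => (c / 12 + c ^ 2 * x ^ 2 / 2) by
      fun_prop).continuousAt.isBigO_one ℝ
  have hx : (fun x : ℝ => x ^ 6) =O[𝓝 0] fun x : ℝ => x ^ 6 := Asymptotics.isBigO_refl _ _
  have h₁ :=
    ((log_one_sub_add_sum_isBigO 2).comp_tendsto hq).trans (k := fun x : ℝ => x ^ 6) (by
      refine ((hbd.pow 3).mul hx).neg_left.congr (fun x => ?_) (fun x => ?_)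
      · simp only [Function.comp]; ring
      · ring)
  have h₂ : (fun x : ℝ => (c / 12 + c ^ 2 * x ^ 2 / 2) * x ^ 6) =O[𝓝 0] fun x : ℝ => x ^ 6 :=
    (hbd'.mul hx).congr_right fun x => by ring
  have h := (h₁.sub h₂).trans_isLittleO
    (Asymptotics.isLittleO_pow_pow (show 5 < 6 by norm_num))
  refine h.tendsto_div_nhds_zero.congr fun x => ?_
  have hlog : 1 - -(x ^ 2 / 12 + c * x ^ 4) = 1 + x ^ 2 / 12 + c * x ^ 4 := by ring
  simp only [Function.comp, Finset.sum_range_succ, Finset.sum_range_zero, hlog]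
  push_cast
  ring

/-- Leading coefficient of the expansion of `z n - z (n+1)` when `a = 1/(12e)`:
`n⁴ (z n - z (n+1)) → 1/480 - 3 b e`. -/
theorem tendsto_pow_four_mul_z_sub (b : ℝ)
    (z : ℕ → ℝ)
    (hz : ∀ n : ℕ, 1 ≤ n →
      z n = Real.log (Nat.factorial n) - Real.log (Real.sqrt (2 * π))
        - (1 / 2) * Real.log n
        - n * Real.log ((n : ℝ) / Real.exp 1 + (1 / (12 * Real.exp 1)) / n
            + b / (n : ℝ) ^ 3)) :
    Tendsto (fun n : ℕ => (n : ℝ) ^ 4 * (z n - z (n + 1))) atTop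
      (𝓝 (1 / 480 - 3 * b * Real.exp 1)) := by
  set c : ℝ := b * Real.exp 1 with hc
  let R : ℝ → ℝ := fun x => 3 / 40 + x / 10 - 1 / (12 * (1 + x))
    - (c - 1 / 288) * (3 + 3 * x + x ^ 2) / (1 + x) ^ 3
  have hinv : Tendsto (fun n : ℕ => 1 / (n : ℝ)) atTop (𝓝 0) := tendsto_one_div_atTop_nhds_zero_nat
  have hinv' : Tendsto (fun n : ℕ => 1 / ((n : ℝ) + 1)) atTop (𝓝 0) :=
    tendsto_one_div_add_atTop_nhds_zero_nat
  have hk := tendsto_log_one_add_sub_taylor_div_pow_five.comp hinv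
  have hh := tendsto_log_even_quartic_sub_taylor_div_pow_five c
  have hR : Tendsto R (𝓝 0) (𝓝 (R 0)) := by
    have : ContinuousAt R 0 := by
      refine ContinuousAt.sub (ContinuousAt.sub (by fun_prop) ?_) ?_
      · exact ContinuousAt.div (by fun_prop) (by fun_prop) (by norm_num)
      · exact ContinuousAt.div (by fun_prop) (by fun_prop) (by norm_num)
    exact this
  have hlogu : ∀ᶠ x : ℝ in 𝓝 0, 0 < 1 + x ^ 2 / 12 + c * x ^ 4 := by
    have : Continuous fun x : ℝ => 1 + x ^ 2 / 12 + c * x ^ 4 := by fun_prop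
    exact this.continuousAt.eventually (lt_mem_nhds (by norm_num))
  have hsplit : ∀ x : ℝ, 0 < x → 0 < 1 + (1 / x) ^ 2 / 12 + c * (1 / x) ^ 4 →
      Real.log (x / Real.exp 1 + (1 / (12 * Real.exp 1)) / x + b / x ^ 3)
        = Real.log x - 1 + Real.log (1 + (1 / x) ^ 2 / 12 + c * (1 / x) ^ 4) := by
    intro x hx hu
    have he := Real.exp_pos 1
    rw [show x / Real.exp 1 + (1 / (12 * Real.exp 1)) / x + b / x ^ 3
        = x / Real.exp 1 * (1 + (1 / x) ^ 2 / 12 + c * (1 / x) ^ 4) by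
          rw [hc]; field_simp,
      Real.log_mul (by positivity) hu.ne', Real.log_div hx.ne' he.ne', Real.log_exp]
  have hratio : Tendsto (fun n : ℕ => (1 - 1 / ((n : ℝ) + 1)) ^ 4) atTop (𝓝 ((1 - 0) ^ 4)) :=
    (hinv'.const_sub 1).pow 4
  have hmain := ((((hinv.div_const 2).const_add 1).mul hk).sub (hh.comp hinv)).add
    (hratio.mul (hh.comp hinv')) |>.add (hR.comp hinv)
  have hval : (1 + 0 / 2) * 0 - 0 + (1 - 0) ^ 4 * 0 + R 0 = 1 / 480 - 3 * b * Real.exp 1 := by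
    simp only [R, hc]; ring
  rw [hval] at hmain
  refine hmain.congr' ?_
  filter_upwards [eventually_ge_atTop 1, hinv.eventually hlogu, hinv'.eventually hlogu]
    with n hn hu hu'
  have hn0 : (0 : ℝ) < n := by exact_mod_cast hn
  have hlog1 : Real.log (1 + 1 / (n : ℝ)) = Real.log ((n : ℝ) + 1) - Real.log n := by
    rw [← Real.log_div (by positivity) hn0.ne']
    congr 1
    field_simp
  rw [hz n hn, hz (n + 1) (by omega), Nat.factorial_succ]
  push_cast
  rw [Real.log_mul (by positivity) (by positivity), hsplit n hn0 hu,
    hsplit ((n : ℝ) + 1) (by positivity) hu']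
  simp only [Function.comp, R, hlog1]
  generalize Real.log (1 + (1 / (n : ℝ)) ^ 2 / 12 + c * (1 / (n : ℝ)) ^ 4) = U
  generalize Real.log (1 + (1 / ((n : ℝ) + 1)) ^ 2 / 12 + c * (1 / ((n : ℝ) + 1)) ^ 4) = V
  generalize Real.log ((n : ℝ) + 1) = L'
  generalize Real.log (n : ℝ) = L
  generalize (n : ℝ) = x at *
  field_simp
  ring
end

section
/- For a real parameter b with b ≠ 1/(1440e), set a = 1/(12e) and define z_n = ln(n!) − ln(√(2π)) − (1/2)·ln n − n·ln(n/e + a/n + b/n³) for n ≥ 1. Then lim_{n→∞} n³·z_n = 1/1440 − b·e, which is nonzero; in particular the rate of convergence of (z_n) to zero is n^{−3}. -/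
open Filter Topology Real

/-- If `d` tends to `0` and its increments are dominated by those of a sequence `g` tending to `0`,
then `d` is dominated by `g`. -/
lemma abs_le_of_abs_sub_succ_le {d g : ℕ → ℝ} (hd : Tendsto d atTop (𝓝 0))
    (hg : Tendsto g atTop (𝓝 0)) (h : ∀ n, |d n - d (n + 1)| ≤ g n - g (n + 1)) (n : ℕ) :
    |d n| ≤ g n := by
  have hanti : Antitone fun n => g n - d n :=
    antitone_nat_of_succ_le fun n => by linarith [(abs_le.1 (h n)).2]
  have hanti' : Antitone fun n => g n + d n :=
    antitone_nat_of_succ_le fun n => by linarith [(abs_le.1 (h n)).1]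
  have h₁ := hanti.le_of_tendsto (by simpa using hg.sub hd) n
  have h₂ := hanti'.le_of_tendsto (by simpa using hg.add hd) n
  exact abs_le.2 ⟨by linarith, by linarith⟩

/-- Increments of `log (stirlingSeq n)` up to the third order in `1 / (2n + 1) ^ 2`. -/
lemma log_stirlingSeq_sub_succ_bounds (m : ℕ) {s : ℝ}
    (hs : s = (1 / (2 * ((m : ℝ) + 1) + 1)) ^ 2) :
    s / 3 + s ^ 2 / 5 ≤
        log (Stirling.stirlingSeq (m + 1)) - log (Stirling.stirlingSeq (m + 2)) ∧
      log (Stirling.stirlingSeq (m + 1)) - log (Stirling.stirlingSeq (m + 2)) ≤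
        s / 3 + s ^ 2 / 5 + s ^ 3 / (7 * (1 - s)) := by
  have hm : (0 : ℝ) ≤ m := m.cast_nonneg
  have hs0 : 0 ≤ s := by rw [hs]; positivity
  have hs1 : s < 1 := by
    rw [hs, div_pow, div_lt_one (by positivity)]
    nlinarith
  have hsum := Stirling.log_stirlingSeq_sdiff_hasSum m
  push_cast at hsum
  rw [← hs, ← hasSum_nat_add_iff' 2] at hsum
  simp only [Finset.sum_range_succ, Finset.sum_range_zero] at hsum
  have hgeom : HasSum (fun k : ℕ => s ^ 3 / 7 * s ^ k) (s ^ 3 / 7 * (1 - s)⁻¹) :=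
    (hasSum_geometric_of_lt_one hs0 hs1).mul_left _
  have hnonneg := hsum.nonneg fun k => by positivity
  have hle := hasSum_le (fun k => ?_) hsum hgeom
  · have heq : s ^ 3 / 7 * (1 - s)⁻¹ = s ^ 3 / (7 * (1 - s)) := by
      rw [div_mul_eq_div_div, div_eq_mul_inv (s ^ 3 / 7)]
    rw [heq] at hle
    norm_num at hnonneg hle
    constructor <;> linarith
  · have : s ^ 3 / 7 * s ^ k = 1 / 7 * s ^ (k + 2 + 1) := by ring
    rw [this]
    refine mul_le_mul_of_nonneg_right ?_ (by positivity)
    push_cast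
    exact one_div_le_one_div_of_le (by norm_num) (by linarith [k.cast_nonneg (α := ℝ)])

/-- Rational bound for the increments, written in terms of `w = n (n + 1)`, of the remainder of
Stirling's series after two terms. -/
lemma stirling_increment_bound {w s L : ℝ} (hw : 2 ≤ w) (hs : s = 1 / (4 * w + 1))
    (h₁ : s / 3 + s ^ 2 / 5 ≤ L) (h₂ : L ≤ s / 3 + s ^ 2 / 5 + s ^ 3 / (7 * (1 - s))) :
    |L - 1 / 12 * (1 / w) + 1 / 360 * ((3 * w + 1) / w ^ 3)| ≤ 1 / w ^ 3 := by
  have hw0 : 0 < w := by linarith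
  have htail : s ^ 3 / (7 * (1 - s)) = 1 / (28 * w * (4 * w + 1) ^ 2) := by
    have : 1 - s = 4 * w * s := by rw [hs]; field_simp; ring
    rw [this, hs]; field_simp; ring
  have htail' : 1 / (28 * w * (4 * w + 1) ^ 2) ≤ 1 / 2 * (1 / w ^ 3) := by
    rw [one_div_mul_one_div]
    exact one_div_le_one_div_of_le (by positivity) (by nlinarith [pow_pos hw0 2, pow_pos hw0 3])
  have hmain : s / 3 + s ^ 2 / 5 - 1 / 12 * (1 / w) + 1 / 360 * ((3 * w + 1) / w ^ 3)
      = (10 * w ^ 2 + 11 * w + 1) / (360 * w ^ 3 * (4 * w + 1) ^ 2) := by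
    rw [hs]; field_simp; ring
  have hmain_nonneg : 0 ≤ (10 * w ^ 2 + 11 * w + 1) / (360 * w ^ 3 * (4 * w + 1) ^ 2) := by
    positivity
  have hmain_le : (10 * w ^ 2 + 11 * w + 1) / (360 * w ^ 3 * (4 * w + 1) ^ 2) ≤
      1 / 2 * (1 / w ^ 3) := by
    rw [one_div_mul_one_div, div_le_div_iff₀ (by positivity) (by positivity)]
    nlinarith [pow_pos hw0 3, pow_pos hw0 4, pow_pos hw0 5]
  have hw3 : 0 < 1 / w ^ 3 := by positivity
  exact abs_le.2 ⟨by linarith, by linarith⟩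

/-- The next term of Stirling's series for `log n!`. -/
lemma tendsto_cube_mul_log_stirlingSeq :
    Tendsto (fun n : ℕ => (n : ℝ) ^ 3 *
      (log (Stirling.stirlingSeq n) - log √π - 1 / (12 * n))) atTop (𝓝 (-1 / 360)) := by
  set d : ℕ → ℝ := fun m => log (Stirling.stirlingSeq (m + 1)) - log √π
    - 1 / 12 * (1 / ((m : ℝ) + 1)) + 1 / 360 * (1 / ((m : ℝ) + 1)) ^ 3 with hd
  set g : ℕ → ℝ := fun m => (1 / ((m : ℝ) + 1)) ^ 4 with hg
  have hinv : Tendsto (fun m : ℕ => 1 / ((m : ℝ) + 1)) atTop (𝓝 0) :=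
    tendsto_one_div_add_atTop_nhds_zero_nat
  have hπ : √π ≠ 0 := by positivity
  have hd0 : Tendsto d atTop (𝓝 0) := by
    have h := ((Stirling.tendsto_stirlingSeq_sqrt_pi.log hπ).comp (tendsto_add_atTop_nat 1))
    simpa [hd, -one_div] using ((h.sub_const (log √π)).sub (hinv.const_mul (1 / 12))).add
      ((hinv.pow 3).const_mul (1 / 360))
  have hg0 : Tendsto g atTop (𝓝 0) := by simpa [hg] using hinv.pow 4
  have hstep (m : ℕ) : |d m - d (m + 1)| ≤ g m - g (m + 1) := by
    have hm : (0 : ℝ) ≤ m := m.cast_nonneg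
    set w : ℝ := ((m : ℝ) + 1) * (m + 2) with hw
    have hw2 : 2 ≤ w := by nlinarith
    have hs : (1 / (2 * ((m : ℝ) + 1) + 1)) ^ 2 = 1 / (4 * w + 1) := by
      rw [hw, div_pow, one_pow]; congr 1; ring
    obtain ⟨h₁, h₂⟩ := log_stirlingSeq_sub_succ_bounds m rfl
    have h := stirling_increment_bound hw2 hs h₁ h₂
    have hcast : ((m + 1 : ℕ) : ℝ) + 1 = m + 2 := by push_cast; ring
    have hdd : d m - d (m + 1) = log (Stirling.stirlingSeq (m + 1)) -
        log (Stirling.stirlingSeq (m + 2)) - 1 / 12 * (1 / w) +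
          1 / 360 * ((3 * w + 1) / w ^ 3) := by
      simp only [hd, hcast, hw]
      field_simp
      ring
    have hgg : g m - g (m + 1) = (2 * m + 3) * (2 * w + 1) / w * (1 / w ^ 3) := by
      simp only [hg, hcast, hw]
      field_simp
      ring
    rw [hdd, hgg]
    refine h.trans (le_mul_of_one_le_left (by positivity) ?_)
    rw [one_le_div (by positivity)]
    nlinarith
  have hbound := abs_le_of_abs_sub_succ_le hd0 hg0 hstep
  have hlim : Tendsto (fun m : ℕ => ((m : ℝ) + 1) ^ 3 * d m) atTop (𝓝 0) := by
    refine squeeze_zero_norm (fun m => ?_) hinv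
    have hm : (0 : ℝ) < (m : ℝ) + 1 := by positivity
    rw [norm_mul, Real.norm_eq_abs, Real.norm_eq_abs, abs_of_pos (pow_pos hm 3)]
    calc ((m : ℝ) + 1) ^ 3 * |d m| ≤ ((m : ℝ) + 1) ^ 3 * g m := by gcongr; exact hbound m
      _ = 1 / ((m : ℝ) + 1) := by simp only [hg]; field_simp
  rw [← tendsto_add_atTop_iff_nat 1]
  have := hlim.sub_const (1 / 360)
  rw [zero_sub, ← neg_div] at this
  refine this.congr fun m => ?_
  have hm : ((m : ℝ) + 1) ≠ 0 := by positivity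
  simp only [hd]
  push_cast
  field_simp
  ring

/-- Second-order Taylor bound for `log (1 + x)`. -/
lemma abs_log_one_add_sub_le_s5 {x : ℝ} (hx : |x| ≤ 1 / 2) :
    |log (1 + x) - x + x ^ 2 / 2| ≤ 2 * |x| ^ 3 := by
  have h := Real.abs_log_sub_add_sum_range_le (x := -x) (by rw [abs_neg]; linarith) 2
  simp only [Finset.sum_range_succ, Finset.sum_range_zero, abs_neg, sub_neg_eq_add] at h
  have h' : |x| ^ 3 / (1 - |x|) ≤ 2 * |x| ^ 3 := by
    rw [div_le_iff₀ (by linarith)]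
    nlinarith [pow_nonneg (abs_nonneg x) 3]
  refine le_trans (le_of_eq ?_) (h.trans h')
  congr 1
  push_cast
  ring

lemma tendsto_quadratic_add_quartic_inv (c : ℝ) :
    Tendsto (fun n : ℕ => 1 / (12 * (n : ℝ) ^ 2) + c / (n : ℝ) ^ 4) atTop (𝓝 0) := by
  have hinv : Tendsto (fun n : ℕ => 1 / (n : ℝ)) atTop (𝓝 0) :=
    tendsto_one_div_atTop_nhds_zero_nat
  have := ((hinv.pow 2).const_mul (1 / 12)).add ((hinv.pow 4).const_mul c)
  simp only [ne_eq, OfNat.ofNat_ne_zero, not_false_eq_true, zero_pow, mul_zero, add_zero] at this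
  refine this.congr fun n => ?_
  simp only [mul_inv, inv_pow, div_eq_mul_inv, one_mul]

lemma tendsto_pow_four_mul_log_one_add (c : ℝ) :
    Tendsto (fun n : ℕ => (n : ℝ) ^ 4 *
      (log (1 + (1 / (12 * (n : ℝ) ^ 2) + c / (n : ℝ) ^ 4)) - 1 / (12 * (n : ℝ) ^ 2)))
      atTop (𝓝 (c - 1 / 288)) := by
  set x : ℕ → ℝ := fun n => 1 / (12 * (n : ℝ) ^ 2) + c / (n : ℝ) ^ 4 with hx
  have hinv : Tendsto (fun n : ℕ => 1 / (n : ℝ)) atTop (𝓝 0) :=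
    tendsto_one_div_atTop_nhds_zero_nat
  have hx0 : Tendsto x atTop (𝓝 0) := tendsto_quadratic_add_quartic_inv c
  have hsq : Tendsto (fun n : ℕ => (n : ℝ) ^ 2 * x n) atTop (𝓝 (1 / 12)) := by
    have := ((hinv.pow 2).const_mul c).const_add (1 / 12)
    simp only [ne_eq, OfNat.ofNat_ne_zero, not_false_eq_true, zero_pow, mul_zero, add_zero] at this
    refine this.congr' ?_
    filter_upwards [eventually_ne_atTop 0] with n hn
    have : (n : ℝ) ≠ 0 := by exact_mod_cast hn
    simp only [hx]
    field_simp
  have hrem : Tendsto (fun n : ℕ => (n : ℝ) ^ 4 * (log (1 + x n) - x n + x n ^ 2 / 2)) atTop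
      (𝓝 0) := by
    have hb : Tendsto (fun n : ℕ => 2 * (((n : ℝ) ^ 2 * x n) ^ 2 * |x n|)) atTop (𝓝 0) := by
      simpa using ((hsq.pow 2).mul hx0.abs).const_mul 2
    refine squeeze_zero_norm' ?_ hb
    have hsmall : ∀ᶠ n in atTop, |x n| < 1 / 2 :=
      hx0.abs.eventually_lt_const (by norm_num)
    filter_upwards [hsmall] with n hn
    rw [norm_mul, Real.norm_eq_abs, Real.norm_eq_abs, abs_of_nonneg (by positivity)]
    calc (n : ℝ) ^ 4 * |log (1 + x n) - x n + x n ^ 2 / 2|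
        ≤ (n : ℝ) ^ 4 * (2 * |x n| ^ 3) := by gcongr; exact abs_log_one_add_sub_le_s5 hn.le
      _ = 2 * (((n : ℝ) ^ 2 * x n) ^ 2 * |x n|) := by
        rw [pow_succ |x n|, sq_abs]; ring
  have hlim := (hrem.const_add c).sub ((hsq.pow 2).div_const 2)
  have hval : c + 0 - (1 / 12 : ℝ) ^ 2 / 2 = c - 1 / 288 := by ring
  rw [hval] at hlim
  refine hlim.congr' ?_
  filter_upwards [eventually_ne_atTop 0] with n hn
  have hn0 : (n : ℝ) ≠ 0 := by exact_mod_cast hn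
  have hc : c = (n : ℝ) ^ 4 * (x n - 1 / (12 * (n : ℝ) ^ 2)) := by
    simp only [hx]; field_simp; ring
  linear_combination hc

/-- Theorem 2.1 (ii): with `a = 1/(12e)` and `b ≠ 1/(1440e)`, one has
`n³ * z n → 1/1440 - b e ≠ 0`, so the rate of convergence of `z n` to zero
is `n⁻³`. -/
theorem tendsto_cube_mul_z (b : ℝ) (hb : b ≠ 1 / (1440 * Real.exp 1))
    (z : ℕ → ℝ)
    (hz : ∀ n : ℕ, 1 ≤ n →
      z n = Real.log (Nat.factorial n) - Real.log (Real.sqrt (2 * π))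
        - (1 / 2) * Real.log n
        - n * Real.log ((n : ℝ) / Real.exp 1 + (1 / (12 * Real.exp 1)) / n
            + b / (n : ℝ) ^ 3)) :
    Tendsto (fun n : ℕ => (n : ℝ) ^ 3 * z n) atTop
      (𝓝 (1 / 1440 - b * Real.exp 1)) ∧
      1 / 1440 - b * Real.exp 1 ≠ 0 := by
  refine ⟨?_, fun h => hb ?_⟩
  · have hlim := tendsto_cube_mul_log_stirlingSeq.sub
      (tendsto_pow_four_mul_log_one_add (b * Real.exp 1))
    have hval : (-1 / 360 : ℝ) - (b * Real.exp 1 - 1 / 288) = 1 / 1440 - b * Real.exp 1 := by ring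
    rw [hval] at hlim
    have hpos : ∀ᶠ n : ℕ in atTop,
        1 + (1 / (12 * (n : ℝ) ^ 2) + b * Real.exp 1 / (n : ℝ) ^ 4) ≠ 0 := by
      have h := (tendsto_quadratic_add_quartic_inv (b * Real.exp 1)).const_add 1
      exact h.eventually_ne (by norm_num)
    refine hlim.congr' ?_
    filter_upwards [hpos, eventually_ge_atTop 1] with n hn hn1
    have hn0 : (n : ℝ) ≠ 0 := by positivity
    have he : Real.exp 1 ≠ 0 := (Real.exp_pos 1).ne'
    have hfactor : (n : ℝ) / Real.exp 1 + (1 / (12 * Real.exp 1)) / n + b / (n : ℝ) ^ 3 =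
        n / Real.exp 1 * (1 + (1 / (12 * (n : ℝ) ^ 2) + b * Real.exp 1 / (n : ℝ) ^ 4)) := by
      field_simp
      ring
    have hdiv : log ((n : ℝ) / Real.exp 1) = log n - 1 := by rw [log_div hn0 he, log_exp]
    have hπ : log √(2 * π) = log 2 / 2 + log √π := by
      rw [log_sqrt (by positivity), log_sqrt pi_pos.le, log_mul two_ne_zero pi_ne_zero]
      ring
    have h2n : log (2 * (n : ℝ)) = log 2 + log n := log_mul two_ne_zero hn0
    rw [hz n hn1, hfactor, log_mul (div_ne_zero hn0 he) hn, Stirling.log_stirlingSeq_formula,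
      hπ, h2n, hdiv]
    field_simp
    ring
  · have he : Real.exp 1 ≠ 0 := (Real.exp_pos 1).ne'
    field_simp
    linarith
end

section
/- Set a = 1/(12e) and b = 1/(1440e), and define z_n = ln(n!) − ln(√(2π)) − (1/2)·ln n − n·ln(n/e + a/n + b/n³) for n ≥ 1. Then lim_{n→∞} n⁶·(z_n − z_{n+1}) = 239/72576. -/
open Filter Topology Real

open Asymptotics in
theorem Real.log_one_add_sub_taylor_isBigO (k : ℕ) :
    (fun t : ℝ => log (1 + t) - ∑ i ∈ Finset.range k, (-1) ^ i * t ^ (i + 1) / (i + 1))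
      =O[𝓝 0] fun t => t ^ (k + 1) := by
  refine IsBigO.of_bound 2 ?_
  filter_upwards [Metric.ball_mem_nhds (0 : ℝ) one_half_pos] with t ht
  rw [Metric.mem_ball, dist_zero_right, norm_eq_abs] at ht
  have h := abs_log_sub_add_sum_range_le (x := -t) (by rw [abs_neg]; linarith) k
  have hsum : ∑ i ∈ Finset.range k, (-t) ^ (i + 1) / ((i : ℝ) + 1)
      = -∑ i ∈ Finset.range k, (-1) ^ i * t ^ (i + 1) / ((i : ℝ) + 1) := by
    rw [← Finset.sum_neg_distrib]
    refine Finset.sum_congr rfl fun i _ => ?_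
    rw [neg_pow, pow_succ (-1 : ℝ)]
    ring
  rw [hsum, sub_neg_eq_add, abs_neg, neg_add_eq_sub] at h
  rw [norm_eq_abs, norm_eq_abs, abs_pow]
  refine h.trans ?_
  rw [div_le_iff₀ (by linarith)]
  nlinarith [pow_nonneg (abs_nonneg t) (k + 1)]

/-- The increment of the logarithmic error, multiplied by `x` and written in `x = 1 / n`. -/
noncomputable def stirlingIncrement (x : ℝ) : ℝ :=
  (1 + x / 2) * log (1 + x) - x - log (1 + (x ^ 2 / 12 + x ^ 4 / 1440))
    + (1 + x) * log (1 + ((x / (1 + x)) ^ 2 / 12 + (x / (1 + x)) ^ 4 / 1440))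

open Asymptotics in
theorem stirlingIncrement_sub_isBigO :
    (fun x => stirlingIncrement x - 239 / 72576 * x ^ 7) =O[𝓝 0] fun x => x ^ 8 := by
  have hu {y : ℝ → ℝ} (hy : y =O[𝓝 0] fun x => x) (hy0 : Tendsto y (𝓝 0) (𝓝 0)) :
      (fun x => log (1 + (y x ^ 2 / 12 + y x ^ 4 / 1440))
        - ∑ i ∈ Finset.range 3, (-1) ^ i * (y x ^ 2 / 12 + y x ^ 4 / 1440) ^ (i + 1) / ((i : ℝ) + 1))
      =O[𝓝 0] fun x => x ^ 8 := by
    have ht : Tendsto (fun x => y x ^ 2 / 12 + y x ^ 4 / 1440) (𝓝 0) (𝓝 0) := by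
      simpa using ((hy0.pow 2).div_const 12).add ((hy0.pow 4).div_const 1440)
    have hc : (fun x => 1 / 12 + y x ^ 2 / 1440) =O[𝓝 0] fun _ => (1 : ℝ) :=
      (tendsto_const_nhds.add ((hy0.pow 2).div_const 1440)).isBigO_one ℝ
    have hb : (fun x => y x ^ 2 / 12 + y x ^ 4 / 1440) =O[𝓝 0] fun x => x ^ 2 :=
      ((hy.pow 2).mul hc).congr (fun x => by ring) fun x => by ring
    exact (((Real.log_one_add_sub_taylor_isBigO 3).comp_tendsto ht).trans (hb.pow 4)).congr_right
      fun x => by ring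
  have hy0 : Tendsto (fun x : ℝ => x / (1 + x)) (𝓝 0) (𝓝 0) := by
    have : ContinuousAt (fun x : ℝ => x / (1 + x)) 0 := by fun_prop (disch := norm_num)
    simpa using this.tendsto
  have hy : (fun x : ℝ => x / (1 + x)) =O[𝓝 0] fun x => x := by
    have : ContinuousAt (fun x : ℝ => 1 / (1 + x)) 0 := by fun_prop (disch := norm_num)
    exact ((isBigO_refl (fun x : ℝ => x) (𝓝 0)).mul (this.tendsto.isBigO_one ℝ)).congr
      (fun x => by ring) fun x => by ring
  have h₁ : (fun x : ℝ => 1 + x / 2) =O[𝓝 0] fun _ => (1 : ℝ) :=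
    (by fun_prop : ContinuousAt (fun x : ℝ => 1 + x / 2) 0).tendsto.isBigO_one ℝ
  have h₂ : (fun x : ℝ => 1 + x) =O[𝓝 0] fun _ => (1 : ℝ) :=
    (by fun_prop : ContinuousAt (fun x : ℝ => 1 + x) 0).tendsto.isBigO_one ℝ
  let q : ℝ → ℝ := fun x =>
    ((7218720000 + 77539915440 * x + 377452662480 * x ^ 2
       + 1098852861240 * x ^ 3 + 2125208664000 * x ^ 4 + 2866255980763 * x ^ 5
       + 2749890835055 * x ^ 6 + 1876047891405 * x ^ 7 + 891537224250 * x ^ 8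
       + 280924023966 * x ^ 9 + 52791140886 * x ^ 10 + 4478547810 * x ^ 11
       - 28875 * x ^ 12 - 2905 * x ^ 13 - 77 * x ^ 14
       - 7 * x ^ 15) / 62705664000) / (1 + x) ^ 11
  have hq : q =O[𝓝 0] fun _ => (1 : ℝ) := by
    have : ContinuousAt q 0 := by
      unfold q
      fun_prop (disch := norm_num)
    exact this.tendsto.isBigO_one ℝ
  have hmain := (((h₁.mul (Real.log_one_add_sub_taylor_isBigO 7)).congr_right
      fun x => one_mul _).sub (hu (isBigO_refl _ _) tendsto_id)).add
    ((h₂.mul (hu hy hy0)).congr_right fun x => one_mul _) |>.add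
    (((isBigO_refl (fun x : ℝ => x ^ 8) (𝓝 0)).mul hq).congr_right fun x => mul_one _)
  refine hmain.congr' ?_ .rfl
  filter_upwards [Ioi_mem_nhds (show (-1 : ℝ) < 0 by norm_num)] with x hx
  have hx' : 1 + x ≠ 0 := by
    have : -1 < x := hx
    linarith
  have key : (1 + x / 2) * (∑ i ∈ Finset.range 7, (-1) ^ i * x ^ (i + 1) / ((i : ℝ) + 1)) - x
      - (∑ i ∈ Finset.range 3, (-1) ^ i * (x ^ 2 / 12 + x ^ 4 / 1440) ^ (i + 1) / ((i : ℝ) + 1))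
      + (1 + x) * (∑ i ∈ Finset.range 3, (-1) ^ i *
          ((x / (1 + x)) ^ 2 / 12 + (x / (1 + x)) ^ 4 / 1440) ^ (i + 1) / ((i : ℝ) + 1))
      - 239 / 72576 * x ^ 7 = x ^ 8 * q x := by
    simp only [Finset.sum_range_succ, Finset.sum_range_zero, q]
    push_cast
    field_simp
    ring
  simp only [stirlingIncrement]
  linear_combination -key

open Asymptotics in
theorem tendsto_stirlingIncrement_div :
    Tendsto (fun x => stirlingIncrement x / x ^ 7) (𝓝[≠] 0) (𝓝 (239 / 72576)) := by
  have h : (fun x => stirlingIncrement x - 239 / 72576 * x ^ 7) =o[𝓝 0] fun x : ℝ => x ^ 7 :=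
    stirlingIncrement_sub_isBigO.trans_isLittleO (isLittleO_pow_pow (by norm_num))
  have h' := ((h.mono nhdsWithin_le_nhds).tendsto_div_nhds_zero
    (l := 𝓝[≠] (0 : ℝ))).add_const (239 / 72576 : ℝ)
  rw [zero_add] at h'
  refine h'.congr' ?_
  filter_upwards [self_mem_nhdsWithin] with x hx
  have hx' : x ≠ 0 := hx
  field_simp
  ring

theorem log_stirling_base {x : ℝ} (hx : 0 < x) :
    log (x / exp 1 + (1 / (12 * exp 1)) / x + (1 / (1440 * exp 1)) / x ^ 3)
      = log x - 1 + log (1 + ((1 / x) ^ 2 / 12 + (1 / x) ^ 4 / 1440)) := by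
  have h : x / exp 1 + (1 / (12 * exp 1)) / x + (1 / (1440 * exp 1)) / x ^ 3
      = x / exp 1 * (1 + ((1 / x) ^ 2 / 12 + (1 / x) ^ 4 / 1440)) := by
    field_simp
    ring
  rw [h, log_mul (by positivity) (by positivity), log_div hx.ne' (exp_pos 1).ne', log_exp]

/-- With `a = 1/(12e)` and `b = 1/(1440e)`:
`n⁶ (z n - z (n+1)) → 239/72576`. -/
theorem tendsto_pow_six_mul_z_sub
    (z : ℕ → ℝ)
    (hz : ∀ n : ℕ, 1 ≤ n →
      z n = Real.log (Nat.factorial n) - Real.log (Real.sqrt (2 * π))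
        - (1 / 2) * Real.log n
        - n * Real.log ((n : ℝ) / Real.exp 1 + (1 / (12 * Real.exp 1)) / n
            + (1 / (1440 * Real.exp 1)) / (n : ℝ) ^ 3)) :
    Tendsto (fun n : ℕ => (n : ℝ) ^ 6 * (z n - z (n + 1))) atTop
      (𝓝 (239 / 72576)) := by
  have hlim : Tendsto (fun n : ℕ => (1 : ℝ) / n) atTop (𝓝[≠] 0) :=
    tendsto_nhdsWithin_iff.2 ⟨tendsto_one_div_atTop_nhds_zero_nat, by
      filter_upwards [eventually_gt_atTop 0] with n hn
      have : (0 : ℝ) < n := by exact_mod_cast hn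
      exact (one_div_pos.2 this).ne'⟩
  refine (tendsto_stirlingIncrement_div.comp hlim).congr' ?_
  filter_upwards [eventually_ge_atTop 1] with n hn
  have hn0 : (0 : ℝ) < n := by exact_mod_cast hn
  have hn1 : (0 : ℝ) < n + 1 := by positivity
  have hfac : log ((n + 1).factorial : ℝ) = log ((n : ℝ) + 1) + log (n.factorial : ℝ) := by
    rw [Nat.factorial_succ]
    push_cast
    exact log_mul hn1.ne' (by positivity)
  have hlog : log (1 + 1 / (n : ℝ)) = log ((n : ℝ) + 1) - log n := by
    rw [← log_div hn1.ne' hn0.ne']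
    congr 1
    field_simp
  have hy : 1 / (n : ℝ) / (1 + 1 / n) = 1 / (n + 1) := by
    field_simp
  rw [hz n hn, hz (n + 1) (by lia), hfac]
  push_cast
  rw [log_stirling_base hn0, log_stirling_base hn1, Function.comp_apply, stirlingIncrement, hy,
    hlog]
  generalize log (1 + ((1 / (n : ℝ)) ^ 2 / 12 + (1 / (n : ℝ)) ^ 4 / 1440)) = A
  generalize log (1 + ((1 / ((n : ℝ) + 1)) ^ 2 / 12 + (1 / ((n : ℝ) + 1)) ^ 4 / 1440)) = B
  field_simp
  ring
end

section
/- The approximation n! ≈ √(2πn)·(n/e + 1/(12en) + 1/(1440en³))ⁿ is asymptotically correct, i.e., lim_{n→∞} n! / ( √(2πn)·(n/e + 1/(12en) + 1/(1440en³))ⁿ ) = 1. -/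
open Filter Topology Real

/-- The correction factor of the improved Stirling formula tends to `1`. -/
lemma tendsto_stirling_correction_pow :
    Tendsto (fun n : ℕ =>
      (1 + (1 / (12 * (n : ℝ) ^ 2) + 1 / (1440 * (n : ℝ) ^ 4))) ^ n) atTop (𝓝 1) := by
  have key := Real.tendsto_one_add_pow_exp_of_tendsto (t := 0)
    (g := fun n : ℕ => 1 / (12 * (n : ℝ) ^ 2) + 1 / (1440 * (n : ℝ) ^ 4))
  rw [Real.exp_zero] at key
  refine key ?_
  have h : Tendsto (fun n : ℕ => (n : ℝ)⁻¹) atTop (𝓝 0) := tendsto_inv_atTop_nhds_zero_nat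
  have h' := (h.const_mul (1 / 12)).add ((h.pow 3).const_mul (1 / 1440))
  rw [zero_pow three_ne_zero, mul_zero, mul_zero, add_zero] at h'
  refine h'.congr' ?_
  filter_upwards [eventually_ne_atTop 0] with n hn
  field_simp

/-- The improved Stirling-type formula
`n! ∼ √(2πn) (n/e + 1/(12en) + 1/(1440en³))ⁿ`. -/
theorem factorial_asymptotic_w :
    Tendsto (fun n : ℕ =>
      (Nat.factorial n : ℝ) /
        (Real.sqrt (2 * π * n) *
          ((n : ℝ) / Real.exp 1 + 1 / (12 * Real.exp 1 * n)
            + 1 / (1440 * Real.exp 1 * (n : ℝ) ^ 3)) ^ n)) atTop (𝓝 1) := by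
  have hstirling : Tendsto (fun n : ℕ => (Nat.factorial n : ℝ) /
      (√(2 * n * π) * (n / Real.exp 1) ^ n)) atTop (𝓝 1) := by
    refine (Asymptotics.isEquivalent_iff_tendsto_one ?_).1
      Stirling.factorial_isEquivalent_stirling
    filter_upwards [eventually_gt_atTop 0] with n hn
    positivity
  have h := hstirling.div tendsto_stirling_correction_pow one_ne_zero
  rw [div_one] at h
  refine h.congr' ?_
  filter_upwards [eventually_ne_atTop 0] with n hn
  have hbase : (n : ℝ) / Real.exp 1 + 1 / (12 * Real.exp 1 * n)
      + 1 / (1440 * Real.exp 1 * (n : ℝ) ^ 3)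
      = n / Real.exp 1 * (1 + (1 / (12 * (n : ℝ) ^ 2) + 1 / (1440 * (n : ℝ) ^ 4))) := by
    field_simp
    ring
  rw [hbase, mul_pow, mul_right_comm 2 π (n : ℝ), Pi.div_apply, div_div, mul_assoc]
end

section
/- For a real parameter b, define t_n = ln(n!) − ln(√(2π)) − (1/2)·ln(n + b/n⁴) − n·ln(n/e + 1/(12en) + 1/(1440en³)) for n ≥ 1 (for n large enough that n + b/n⁴ > 0). Then lim_{n→∞} n⁶·(t_n − t_{n+1}) = 239/72576 − (5/2)·b. -/
open Filter Topology Real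

open Asymptotics Finset in
/-- Taylor expansion of `log (1 + y)` at `0` with a big-O remainder. -/
theorem log_one_add_taylor_isBigO (n : ℕ) :
    (fun y : ℝ => (∑ i ∈ range n, (-y) ^ (i + 1) / (i + 1)) + Real.log (1 + y))
      =O[𝓝 0] fun y => y ^ (n + 1) := by
  refine IsBigO.of_bound 2 ?_
  filter_upwards [Metric.ball_mem_nhds (0 : ℝ) (by norm_num : (0 : ℝ) < 1 / 2)] with y hy
  have hy' : |y| < 1 / 2 := by simpa using hy
  have h := Real.abs_log_sub_add_sum_range_le (x := -y) (by rw [abs_neg]; linarith) n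
  rw [abs_neg, sub_neg_eq_add] at h
  rw [Real.norm_eq_abs, Real.norm_eq_abs, abs_pow]
  refine h.trans ?_
  rw [div_le_iff₀ (by linarith)]
  nlinarith [pow_nonneg (abs_nonneg y) (n + 1)]

open Asymptotics in
/-- Second-order expansion in `x = 1/n` of the two logarithmic correction factors. -/
theorem log_corrections_isLittleO (b : ℝ) :
    (fun x : ℝ => 1 / 2 * Real.log (1 + b * x ^ 5)
        + x⁻¹ * Real.log (1 + (x ^ 2 / 12 + x ^ 4 / 1440))
        - (x / 12 - x ^ 3 / 360) - (b / 2 + 7 / 51840) * x ^ 5)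
      =o[𝓝[≠] 0] fun x => x ^ 6 := by
  have pow_lt {m : ℕ} (hm : 6 < m) :
      (fun x : ℝ => x ^ m) =o[𝓝[≠] 0] fun x => x ^ 6 :=
    (isLittleO_pow_pow hm).mono nhdsWithin_le_nhds
  have h1 : (fun x : ℝ => Real.log (1 + b * x ^ 5) - b * x ^ 5)
      =o[𝓝[≠] 0] fun x => x ^ 6 := by
    have ht : Tendsto (fun x : ℝ => b * x ^ 5) (𝓝[≠] 0) (𝓝 0) := by
      have : Continuous fun x : ℝ => b * x ^ 5 := by fun_prop
      simpa using (this.tendsto 0).mono_left nhdsWithin_le_nhds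
    have h := (log_one_add_taylor_isBigO 1).comp_tendsto ht
    have h' : (fun x : ℝ => (b * x ^ 5) ^ (1 + 1)) =O[𝓝[≠] 0] fun x => x ^ 10 := by
      have := (isBigO_refl (fun x : ℝ => x ^ 10) (𝓝[≠] 0)).const_mul_left (b ^ 2)
      refine this.congr_left fun x => by ring
    refine ((h.trans h').trans_isLittleO (pow_lt (by norm_num))).congr_left fun x => ?_
    simp
    ring
  have h2 : (fun x : ℝ => x⁻¹ * Real.log (1 + (x ^ 2 / 12 + x ^ 4 / 1440))
        - (x / 12 - x ^ 3 / 360) - 7 / 51840 * x ^ 5)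
      =o[𝓝[≠] 0] fun x => x ^ 6 := by
    have ht : Tendsto (fun x : ℝ => x ^ 2 / 12 + x ^ 4 / 1440) (𝓝[≠] 0) (𝓝 0) := by
      have : Continuous fun x : ℝ => x ^ 2 / 12 + x ^ 4 / 1440 := by fun_prop
      simpa using (this.tendsto 0).mono_left nhdsWithin_le_nhds
    have h := (log_one_add_taylor_isBigO 3).comp_tendsto ht
    have bounded {f : ℝ → ℝ} (hf : Continuous f) :
        f =O[𝓝[≠] 0] fun _ => (1 : ℝ) :=
      ((hf.tendsto 0).mono_left nhdsWithin_le_nhds).isBigO_one ℝ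
    have h' : (fun x : ℝ => (x ^ 2 / 12 + x ^ 4 / 1440) ^ (3 + 1))
        =O[𝓝[≠] 0] fun x => x ^ 8 := by
      have := (isBigO_refl (fun x : ℝ => x ^ 8) (𝓝[≠] 0)).mul
        (bounded (f := fun x => (1 / 12 + x ^ 2 / 1440) ^ 4) (by fun_prop))
      refine this.congr (fun x => by ring) fun x => by ring
    have h3 := (isBigO_refl (fun x : ℝ => x⁻¹) (𝓝[≠] 0)).mul (h.trans h')
    have h4 : (fun x : ℝ => x⁻¹ * x ^ 8) =o[𝓝[≠] 0] fun x => x ^ 6 := by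
      refine (pow_lt (m := 7) (by norm_num)).congr' ?_ EventuallyEq.rfl
      filter_upwards [self_mem_nhdsWithin] with x hx
      have : x ≠ 0 := hx
      field_simp
    have h5 : (fun x : ℝ => x ^ 7 * (19 / 4147200 + x ^ 2 / 24883200 + x ^ 4 / 8957952000))
        =o[𝓝[≠] 0] fun x => x ^ 6 := by
      have := ((isBigO_refl (fun x : ℝ => x ^ 7) (𝓝[≠] 0)).mul
        (bounded (f := fun x => (19 / 4147200 + x ^ 2 / 24883200 + x ^ 4 / 8957952000)) (by fun_prop)))
      simp only [mul_one] at this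
      exact this.trans_isLittleO (pow_lt (by norm_num))
    refine ((h3.trans_isLittleO h4).add h5).congr' ?_ EventuallyEq.rfl
    filter_upwards [self_mem_nhdsWithin] with x hx
    have : x ≠ 0 := hx
    simp [Finset.sum_range_succ]
    generalize Real.log (1 + (x ^ 2 / 12 + x ^ 4 / 1440)) = L
    field_simp
    ring
  refine ((h1.const_mul_left (1 / 2)).add h2).congr_left fun x => ?_
  ring

open Asymptotics in
/-- Expansion in `x = 1/n` of one Stirling increment minus its two leading terms. -/
theorem tendsto_stirling_increment :
    Tendsto (fun x : ℝ => ((x⁻¹ + 1 / 2) * Real.log (1 + x) - 1 - (x / 12 - x ^ 3 / 360)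
        + ((x / (1 + x)) / 12 - (x / (1 + x)) ^ 3 / 360)) / x ^ 6) (𝓝[≠] 0) (𝓝 (1 / 252)) := by
  have hlog : Tendsto (fun x : ℝ =>
      ((∑ i ∈ Finset.range 7, (-x) ^ (i + 1) / (i + 1)) + Real.log (1 + x)) / x ^ 7)
      (𝓝[≠] 0) (𝓝 0) :=
    (((log_one_add_taylor_isBigO 7).trans_isLittleO
      (isLittleO_pow_pow (by norm_num))).mono nhdsWithin_le_nhds).tendsto_div_nhds_zero
  have h1 : Tendsto (fun x : ℝ => 1 + x / 2) (𝓝[≠] 0) (𝓝 1) := by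
    have : Continuous fun x : ℝ => 1 + x / 2 := by fun_prop
    simpa using (this.tendsto 0).mono_left nhdsWithin_le_nhds
  have h2 : Tendsto (fun x : ℝ =>
      (1 / 252 + x / 8 + 137 / 420 * x ^ 2 + 23 / 84 * x ^ 3 + x ^ 4 / 14) / (1 + x) ^ 3)
      (𝓝[≠] 0) (𝓝 (1 / 252)) := by
    have : ContinuousAt (fun x : ℝ =>
      (1 / 252 + x / 8 + 137 / 420 * x ^ 2 + 23 / 84 * x ^ 3 + x ^ 4 / 14) / (1 + x) ^ 3) 0 := by
      refine ContinuousAt.div (by fun_prop) (by fun_prop) (by norm_num)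
    simpa using this.tendsto.mono_left nhdsWithin_le_nhds
  have h := (h1.mul hlog).add h2
  rw [mul_zero, zero_add] at h
  refine h.congr' ?_
  have hne : ∀ᶠ x : ℝ in 𝓝[≠] 0, 1 + x ≠ 0 := by
    have : Continuous fun x : ℝ => 1 + x := by fun_prop
    exact nhdsWithin_le_nhds (this.continuousAt.eventually_ne (by norm_num))
  filter_upwards [self_mem_nhdsWithin, hne] with x hx hx1
  have : x ≠ 0 := hx
  simp [Finset.sum_range_succ]
  generalize Real.log (1 + x) = L
  field_simp
  ring

/-- If `e n = c / n⁵ + o(1 / n⁶)`, then `n⁶ (e n - e (n + 1)) → 5 c`. -/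
theorem tendsto_pow_six_mul_sub_succ {e : ℕ → ℝ} {c : ℝ}
    (he : Tendsto (fun n : ℕ => (n : ℝ) ^ 6 * (e n - c / (n : ℝ) ^ 5)) atTop (𝓝 0)) :
    Tendsto (fun n : ℕ => (n : ℝ) ^ 6 * (e n - e (n + 1))) atTop (𝓝 (5 * c)) := by
  have hinv : Tendsto (fun n : ℕ => ((n : ℝ))⁻¹) atTop (𝓝 0) := tendsto_inv_atTop_nhds_zero_nat
  have hr : Tendsto (fun n : ℕ => (1 / (1 + ((n : ℝ))⁻¹)) ^ 6) atTop (𝓝 1) := by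
    have : ContinuousAt (fun x : ℝ => (1 / (1 + x)) ^ 6) 0 := by
      refine ContinuousAt.pow (ContinuousAt.div (by fun_prop) (by fun_prop) (by norm_num)) 6
    have h0 := this.tendsto
    simp only [add_zero, div_one, one_pow] at h0
    exact h0.comp hinv
  have hc : Tendsto (fun n : ℕ => c * ((5 + 10 * (n : ℝ)⁻¹ + 10 * (n : ℝ)⁻¹ ^ 2
      + 5 * (n : ℝ)⁻¹ ^ 3 + (n : ℝ)⁻¹ ^ 4) / (1 + (n : ℝ)⁻¹) ^ 5)) atTop (𝓝 (c * 5)) := by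
    have : ContinuousAt (fun x : ℝ => c * ((5 + 10 * x + 10 * x ^ 2 + 5 * x ^ 3 + x ^ 4)
        / (1 + x) ^ 5)) 0 := by
      refine ContinuousAt.mul (by fun_prop)
        (ContinuousAt.div (by fun_prop) (by fun_prop) (by norm_num))
    have h0 := this.tendsto
    norm_num only at h0
    exact h0.comp hinv
  have h := (he.sub (hr.mul (he.comp (tendsto_add_atTop_nat 1)))).add hc
  rw [mul_zero, sub_zero, zero_add, mul_comm c] at h
  refine h.congr' ?_
  filter_upwards [eventually_ge_atTop 1] with n hn
  have hn0 : (n : ℝ) ≠ 0 := by positivity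
  have hn1 : (n : ℝ) + 1 ≠ 0 := by positivity
  simp only [Function.comp_apply, Nat.cast_add, Nat.cast_one]
  field_simp
  ring

/-- Expansion (4), leading coefficient: for the logarithmic error `t n` of the
approximation `n! ≈ √(2π(n + b/n⁴)) (n/e + 1/(12en) + 1/(1440en³))ⁿ`, one has
`n⁶ (t n - t (n+1)) → 239/72576 - (5/2) b`. -/
theorem tendsto_pow_six_mul_t_sub (b : ℝ)
    (t : ℕ → ℝ)
    (ht : ∀ n : ℕ, 1 ≤ n →
      t n = Real.log (Nat.factorial n) - Real.log (Real.sqrt (2 * π))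
        - (1 / 2) * Real.log ((n : ℝ) + b / (n : ℝ) ^ 4)
        - n * Real.log ((n : ℝ) / Real.exp 1 + 1 / (12 * Real.exp 1 * n)
            + 1 / (1440 * Real.exp 1 * (n : ℝ) ^ 3))) :
    Tendsto (fun n : ℕ => (n : ℝ) ^ 6 * (t n - t (n + 1))) atTop
      (𝓝 (239 / 72576 - 5 / 2 * b)) := by
  have hinv : Tendsto (fun n : ℕ => ((n : ℝ))⁻¹) atTop (𝓝[≠] 0) := by
    refine tendsto_nhdsWithin_iff.2 ⟨tendsto_inv_atTop_nhds_zero_nat, ?_⟩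
    filter_upwards [eventually_ge_atTop 1] with n hn
    have hn0 : (n : ℝ) ≠ 0 := by positivity
    simpa using hn0
  let g : ℝ → ℝ := fun x => 1 / 2 * Real.log (1 + b * x ^ 5)
        + x⁻¹ * Real.log (1 + (x ^ 2 / 12 + x ^ 4 / 1440)) - (x / 12 - x ^ 3 / 360)
  have hg : Tendsto (fun n : ℕ => (n : ℝ) ^ 6 *
      (g (n : ℝ)⁻¹ - (b / 2 + 7 / 51840) / (n : ℝ) ^ 5)) atTop (𝓝 0) := by
    refine ((log_corrections_isLittleO b).tendsto_div_nhds_zero.comp hinv).congr fun n => ?_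
    simp only [Function.comp_apply, g, inv_pow, inv_inv, div_eq_mul_inv]
    ring
  have hdiff := tendsto_pow_six_mul_sub_succ (e := fun n : ℕ => g (n : ℝ)⁻¹) hg
  have h := (tendsto_stirling_increment.comp hinv).sub hdiff
  rw [show (239 / 72576 - 5 / 2 * b : ℝ) = 1 / 252 - 5 * (b / 2 + 7 / 51840) by ring]
  refine h.congr' ?_
  have hpos : ∀ᶠ n : ℕ in atTop, 0 < 1 + b * ((n : ℝ)⁻¹) ^ 5 := by
    have hc : Continuous fun x : ℝ => 1 + b * x ^ 5 := by fun_prop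
    have := (hc.tendsto 0).comp (tendsto_inv_atTop_nhds_zero_nat (𝕜 := ℝ))
    exact this.eventually_const_lt (by norm_num)
  have ht' : ∀ n : ℕ, 1 ≤ n → 0 < 1 + b * ((n : ℝ)⁻¹) ^ 5 →
      t n = Real.log (Nat.factorial n) - Real.log (Real.sqrt (2 * π))
        - (n + 1 / 2) * Real.log n + n - ((n : ℝ)⁻¹ / 12 - (n : ℝ)⁻¹ ^ 3 / 360)
        - g (n : ℝ)⁻¹ := by
    intro n hn hp
    have hn0 : (0 : ℝ) < n := by positivity
    have e1 : (n : ℝ) + b / (n : ℝ) ^ 4 = n * (1 + b * ((n : ℝ)⁻¹) ^ 5) := by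
      field_simp
    have e2 : (n : ℝ) / Real.exp 1 + 1 / (12 * Real.exp 1 * n)
            + 1 / (1440 * Real.exp 1 * (n : ℝ) ^ 3)
        = n / Real.exp 1 * (1 + ((n : ℝ)⁻¹ ^ 2 / 12 + (n : ℝ)⁻¹ ^ 4 / 1440)) := by
      field_simp
      ring
    rw [ht n hn, e1, e2, Real.log_mul hn0.ne' hp.ne', Real.log_mul (by positivity) (by positivity),
      Real.log_div hn0.ne' (Real.exp_pos 1).ne', Real.log_exp]
    simp only [g, inv_inv]
    ring
  filter_upwards [eventually_ge_atTop 1, hpos, (tendsto_add_atTop_nat 1).eventually hpos]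
    with n hn hp hp1
  have hn0 : (0 : ℝ) < n := by positivity
  have e3 : Real.log (1 + (n : ℝ)⁻¹) = Real.log (n + 1) - Real.log n := by
    rw [← Real.log_div (by positivity) hn0.ne']
    congr 1
    field_simp
  have e4 : (n : ℝ)⁻¹ / (1 + (n : ℝ)⁻¹) = ((n : ℝ) + 1)⁻¹ := by
    field_simp
  have e5 : Real.log ((n + 1).factorial : ℝ) = Real.log (n + 1) + Real.log (n.factorial) := by
    rw [Nat.factorial_succ, Nat.cast_mul, Real.log_mul (by positivity) (by positivity)]
    push_cast
    rfl
  rw [ht' n hn hp, ht' (n + 1) (by omega) hp1, e5]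
  simp only [Function.comp_apply, e3, e4, inv_inv, inv_pow, div_inv_eq_mul, Nat.cast_add,
    Nat.cast_one]
  ring
end

section
/- For a real parameter b with b ≠ 239/181440, define t_n = ln(n!) − ln(√(2π)) − (1/2)·ln(n + b/n⁴) − n·ln(n/e + 1/(12en) + 1/(1440en³)) for n ≥ 1 (for n large enough that n + b/n⁴ > 0). Then lim_{n→∞} n⁵·t_n = (239/72576 − (5/2)·b)/5, which is nonzero. -/
open Filter Topology Real

/-- The truncation `1/(12x) - 1/(360x³) + 1/(1260x⁵)` of the Stirling series of `log n!`. -/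
noncomputable def stirlingTrunc (x : ℝ) : ℝ :=
  1 / (12 * x) - 1 / (360 * x ^ 3) + 1 / (1260 * x ^ 5)

/-- If the steps of a null sequence are dominated by those of another null sequence, then so are
its terms. -/
theorem abs_le_of_abs_sub_succ_le_s10 {a c : ℕ → ℝ} (ha : Tendsto a atTop (𝓝 0))
    (hc : Tendsto c atTop (𝓝 0)) (h : ∀ n, |a n - a (n + 1)| ≤ c n - c (n + 1)) (n : ℕ) :
    |a n| ≤ c n := by
  have hsub : Antitone (fun n => c n - a n) :=
    antitone_nat_of_succ_le fun n => by linarith [(abs_le.mp (h n)).2]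
  have hadd : Antitone (fun n => c n + a n) :=
    antitone_nat_of_succ_le fun n => by linarith [(abs_le.mp (h n)).1]
  have h₁ := hsub.le_of_tendsto (by simpa using hc.sub ha) n
  have h₂ := hadd.le_of_tendsto (by simpa using hc.add ha) n
  exact abs_le.mpr ⟨by linarith, by linarith⟩

theorem stirlingTrunc_sub_le {x : ℝ} (hx : 1 ≤ x) :
    stirlingTrunc x - stirlingTrunc (x + 1) -
      ((1 / (2 * x + 1)) ^ 2 / 3 + (1 / (2 * x + 1)) ^ 4 / 5 + (1 / (2 * x + 1)) ^ 6 / 7)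
      ≤ 1 / x ^ 6 - 1 / (x + 1) ^ 6 := by
  obtain ⟨k, hk, rfl⟩ : ∃ k : ℝ, 0 ≤ k ∧ x = k + 1 := ⟨x - 1, by linarith, by ring⟩
  rw [← sub_nonneg]
  unfold stirlingTrunc
  field_simp
  ring_nf
  positivity

theorem le_stirlingTrunc_sub {x : ℝ} (hx : 1 ≤ x) :
    (1 / (2 * x + 1)) ^ 2 / 3 + (1 / (2 * x + 1)) ^ 4 / 5 + (1 / (2 * x + 1)) ^ 6 / 7 +
        (1 / (2 * x + 1)) ^ 8 / 8 - (stirlingTrunc x - stirlingTrunc (x + 1))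
      ≤ 1 / x ^ 6 - 1 / (x + 1) ^ 6 := by
  obtain ⟨k, hk, rfl⟩ : ∃ k : ℝ, 0 ≤ k ∧ x = k + 1 := ⟨x - 1, by linarith, by ring⟩
  rw [← sub_nonneg]
  unfold stirlingTrunc
  field_simp
  ring_nf
  positivity

/-- The first three terms of the series for `log (stirlingSeq (m + 1)) - log (stirlingSeq (m + 2))`
approximate it from below, with an error at most `1 / (8 (2 m + 3) ^ 8)`. -/
theorem log_stirlingSeq_sub_mem_Icc (m : ℕ) {y : ℝ} (hy : y = 1 / (2 * ((m : ℝ) + 1) + 1)) :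
    Real.log (Stirling.stirlingSeq (m + 1)) - Real.log (Stirling.stirlingSeq (m + 2)) ∈
      Set.Icc (y ^ 2 / 3 + y ^ 4 / 5 + y ^ 6 / 7)
        (y ^ 2 / 3 + y ^ 4 / 5 + y ^ 6 / 7 + y ^ 8 / 8) := by
  have hy0 : 0 < y := by rw [hy]; positivity
  have hy3 : y ≤ 1 / 3 := by
    rw [hy]
    exact one_div_le_one_div_of_le (by norm_num) (by linarith [m.cast_nonneg (α := ℝ)])
  have hz : y ^ 2 ≤ 1 / 9 := by nlinarith
  have hS := Stirling.log_stirlingSeq_sdiff_hasSum m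
  push_cast at hS
  rw [← hy, ← hasSum_nat_add_iff' 3] at hS
  simp only [Finset.sum_range_succ, Finset.sum_range_zero] at hS
  norm_num at hS
  have hgeo := (hasSum_geometric_of_lt_one (sq_nonneg y) (by linarith)).mul_left (y ^ 8 / 9)
  have h₀ := hS.nonneg fun k => by positivity
  have h₁ := hasSum_le (fun k => ?_) hS hgeo
  · have h₂ : y ^ 8 / 9 * (1 - y ^ 2)⁻¹ ≤ y ^ 8 / 8 := by
      rw [← div_eq_mul_inv, div_div]
      exact div_le_div_of_nonneg_left (by positivity) (by norm_num) (by linarith)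
    constructor <;> nlinarith
  · rw [show y ^ 8 / 9 * (y ^ 2) ^ k = 1 / 9 * (y ^ 2) ^ (k + 3 + 1) by ring]
    refine mul_le_mul_of_nonneg_right ?_ (by positivity)
    rw [← one_div]
    exact one_div_le_one_div_of_le (by norm_num) (by linarith [k.cast_nonneg (α := ℝ)])

theorem tendsto_stirlingTrunc : Tendsto (fun n : ℕ => stirlingTrunc n) atTop (𝓝 0) := by
  have h : Tendsto (fun n : ℕ => ((n : ℝ))⁻¹) atTop (𝓝 0) := tendsto_inv_atTop_nhds_zero_nat
  have := ((h.const_mul (1 / 12)).sub ((h.pow 3).const_mul (1 / 360))).add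
    ((h.pow 5).const_mul (1 / 1260))
  norm_num at this
  refine this.congr fun n => ?_
  simp only [stirlingTrunc, one_div, mul_inv]

theorem abs_log_stirlingSeq_sub_le {n : ℕ} (hn : 1 ≤ n) :
    |Real.log (Stirling.stirlingSeq n) - Real.log (√π) - stirlingTrunc n| ≤ 1 / (n : ℝ) ^ 6 := by
  obtain ⟨m, rfl⟩ : ∃ m, n = m + 1 := ⟨n - 1, by omega⟩
  refine abs_le_of_abs_sub_succ_le_s10
    (a := fun m : ℕ => Real.log (Stirling.stirlingSeq (m + 1)) - Real.log (√π)
      - stirlingTrunc (m + 1 : ℕ)) (c := fun m : ℕ => 1 / ((m + 1 : ℕ) : ℝ) ^ 6) ?_ ?_ ?_ m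
  · have hlog := ((Stirling.tendsto_stirlingSeq_sqrt_pi.log (by positivity)).sub_const
      (Real.log (√π))).sub tendsto_stirlingTrunc
    rw [sub_self, sub_zero] at hlog
    exact hlog.comp (tendsto_add_atTop_nat 1)
  · have h := (tendsto_inv_atTop_nhds_zero_nat (𝕜 := ℝ)).pow 6
    norm_num at h
    simpa [Function.comp_def] using h.comp (tendsto_add_atTop_nat 1)
  · intro k
    have hk : (1 : ℝ) ≤ (k : ℝ) + 1 := by linarith [k.cast_nonneg (α := ℝ)]
    have h₁ := stirlingTrunc_sub_le hk
    have h₂ := le_stirlingTrunc_sub hk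
    obtain ⟨h₃, h₄⟩ := log_stirlingSeq_sub_mem_Icc k rfl
    push_cast
    exact abs_le.mpr ⟨by linarith, by linarith⟩

/-- A sequence within `C/n` of a convergent one has the same limit. -/
theorem tendsto_of_abs_sub_le_inv {f g : ℕ → ℝ} {l : ℝ} (hg : Tendsto g atTop (𝓝 l))
    (h : ∀ n : ℕ, 1 ≤ n → |f n - g n| ≤ (n : ℝ)⁻¹) : Tendsto f atTop (𝓝 l) := by
  have h₀ : Tendsto (fun n => f n - g n) atTop (𝓝 0) :=
    squeeze_zero_norm' ((eventually_ge_atTop 1).mono h) tendsto_inv_atTop_nhds_zero_nat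
  simpa using h₀.add hg

theorem tendsto_pow_five_mul_log_stirlingSeq_sub :
    Tendsto (fun n : ℕ => (n : ℝ) ^ 5 * (Real.log (Stirling.stirlingSeq n) - Real.log (√π)
      - (1 / (12 * (n : ℝ)) - 1 / (360 * (n : ℝ) ^ 3)))) atTop (𝓝 (1 / 1260)) := by
  refine tendsto_of_abs_sub_le_inv tendsto_const_nhds fun n hn => ?_
  have hn0 : (0 : ℝ) < n := by exact_mod_cast hn
  rw [show (n : ℝ) ^ 5 * (Real.log (Stirling.stirlingSeq n) - Real.log (√π)
      - (1 / (12 * (n : ℝ)) - 1 / (360 * (n : ℝ) ^ 3))) - 1 / 1260 = (n : ℝ) ^ 5 *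
      (Real.log (Stirling.stirlingSeq n) - Real.log (√π) - stirlingTrunc n) by
    unfold stirlingTrunc; field, abs_mul, abs_of_pos (pow_pos hn0 5)]
  calc (n : ℝ) ^ 5 * _ ≤ (n : ℝ) ^ 5 * (1 / (n : ℝ) ^ 6) :=
        mul_le_mul_of_nonneg_left (abs_log_stirlingSeq_sub_le hn) (by positivity)
    _ = (n : ℝ)⁻¹ := by field

theorem tendsto_pow_six_mul_log_sub :
    Tendsto (fun n : ℕ => (n : ℝ) ^ 6 *
      (Real.log (1 + (1 / (12 * (n : ℝ) ^ 2) + 1 / (1440 * (n : ℝ) ^ 4)))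
        - (1 / (12 * (n : ℝ) ^ 2) - 1 / (360 * (n : ℝ) ^ 4)))) atTop (𝓝 (7 / 51840)) := by
  have hx : Tendsto (fun n : ℕ => (n : ℝ)⁻¹) atTop (𝓝 0) := tendsto_inv_atTop_nhds_zero_nat
  have hpoly : Continuous fun x : ℝ => -1 / 17280 - x ^ 2 / 4147200 +
      (1 / 12 + x ^ 2 / 1440) ^ 3 / 3 := by fun_prop
  have hg := (hpoly.tendsto 0).comp hx
  norm_num [Function.comp_def] at hg
  refine tendsto_of_abs_sub_le_inv hg fun n hn => ?_
  have hn1 : (1 : ℝ) ≤ n := by exact_mod_cast hn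
  have hn0 : (0 : ℝ) < n := by linarith
  set u : ℝ := 1 / (12 * (n : ℝ) ^ 2) + 1 / (1440 * (n : ℝ) ^ 4) with hu
  have hu0 : 0 < u := by positivity
  have hun : u ≤ 1 / 2 * (1 / (n : ℝ) ^ 2) := by
    rw [hu, ← sub_nonneg]
    have : 1 / 2 * (1 / (n : ℝ) ^ 2) - (1 / (12 * (n : ℝ) ^ 2) + 1 / (1440 * (n : ℝ) ^ 4)) =
        (600 * (n : ℝ) ^ 2 - 1) / (1440 * (n : ℝ) ^ 4) := by field
    rw [this]
    exact div_nonneg (by nlinarith) (by positivity)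
  have hu1 : u ≤ 1 / 2 := hun.trans (by
    have : 1 / (n : ℝ) ^ 2 ≤ 1 := (div_le_one (by positivity)).mpr (one_le_pow₀ hn1)
    linarith)
  have hlog := abs_log_sub_add_sum_range_le (x := -u)
    (by rw [abs_neg, abs_of_pos hu0]; linarith) 3
  rw [abs_neg, abs_of_pos hu0, sub_neg_eq_add] at hlog
  simp only [Finset.sum_range_succ, Finset.sum_range_zero] at hlog
  norm_num at hlog
  have hkey : |-u + u ^ 2 / 2 + -u ^ 3 / 3 + Real.log (1 + u)| ≤ 1 / (n : ℝ) ^ 8 := by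
    refine (le_of_eq (by ring_nf)).trans (hlog.trans ?_)
    calc u ^ 4 / (1 - u) ≤ 2 * u ^ 4 := by
          rw [div_le_iff₀ (by linarith)]
          nlinarith [pow_pos hu0 4]
      _ ≤ 2 * (1 / 2 * (1 / (n : ℝ) ^ 2)) ^ 4 := by gcongr
      _ = 1 / 8 * (1 / (n : ℝ) ^ 8) := by ring
      _ ≤ 1 / (n : ℝ) ^ 8 := by linarith [show 0 < 1 / (n : ℝ) ^ 8 by positivity]
  calc _ = |(n : ℝ) ^ 6 * (-u + u ^ 2 / 2 + -u ^ 3 / 3 + Real.log (1 + u))| := by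
        congr 1
        rw [hu]
        field_simp
        ring
    _ ≤ (n : ℝ) ^ 6 * (1 / (n : ℝ) ^ 8) := by
        rw [abs_mul, abs_of_pos (pow_pos hn0 6)]
        exact mul_le_mul_of_nonneg_left hkey (by positivity)
    _ = (n : ℝ)⁻¹ * (n : ℝ)⁻¹ := by field
    _ ≤ (n : ℝ)⁻¹ := mul_le_of_le_one_right (by positivity) (inv_le_one_of_one_le₀ hn1)

/-- If `b ≠ 239/181440`, then `n⁵ * t n → (239/72576 - (5/2) b)/5 ≠ 0`,
where `t n` is the logarithmic error of the approximation
`n! ≈ √(2π(n + b/n⁴)) (n/e + 1/(12en) + 1/(1440en³))ⁿ`. -/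
theorem tendsto_pow_five_mul_t (b : ℝ) (hb : b ≠ 239 / 181440)
    (t : ℕ → ℝ)
    (ht : ∀ n : ℕ, 1 ≤ n →
      t n = Real.log (Nat.factorial n) - Real.log (Real.sqrt (2 * π))
        - (1 / 2) * Real.log ((n : ℝ) + b / (n : ℝ) ^ 4)
        - n * Real.log ((n : ℝ) / Real.exp 1 + 1 / (12 * Real.exp 1 * n)
            + 1 / (1440 * Real.exp 1 * (n : ℝ) ^ 3))) :
    Tendsto (fun n : ℕ => (n : ℝ) ^ 5 * t n) atTop
      (𝓝 ((239 / 72576 - 5 / 2 * b) / 5)) ∧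
      (239 / 72576 - 5 / 2 * b) / 5 ≠ 0 := by
  refine ⟨?_, fun h => hb (by linarith)⟩
  have hpow : Tendsto (fun n : ℕ => (n : ℝ) ^ 5) atTop atTop :=
    (tendsto_pow_atTop (by norm_num)).comp tendsto_natCast_atTop_atTop
  have hlogb := (Real.tendsto_mul_log_one_add_div_atTop b).comp hpow
  have hlim := (tendsto_pow_five_mul_log_stirlingSeq_sub.sub (hlogb.const_mul (1 / 2))).sub
    tendsto_pow_six_mul_log_sub
  rw [show (239 / 72576 - 5 / 2 * b) / 5 = 1 / 1260 - 1 / 2 * b - 7 / 51840 by ring]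
  refine hlim.congr' ?_
  have hpos : ∀ᶠ n : ℕ in atTop, 0 < 1 + b / (n : ℝ) ^ 5 := by
    have h : Tendsto (fun n : ℕ => 1 + b / (n : ℝ) ^ 5) atTop (𝓝 1) := by
      simpa using (hpow.const_div_atTop b).const_add 1
    exact h.eventually_const_lt one_pos
  filter_upwards [hpos, eventually_ge_atTop 1] with n hbn hn
  have hn0 : (0 : ℝ) < n := by exact_mod_cast hn
  rw [ht n hn, Stirling.log_stirlingSeq_formula,
    show (n : ℝ) + b / (n : ℝ) ^ 4 = n * (1 + b / (n : ℝ) ^ 5) by field,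
    show (n : ℝ) / Real.exp 1 + 1 / (12 * Real.exp 1 * n) + 1 / (1440 * Real.exp 1 * (n : ℝ) ^ 3) =
      n / Real.exp 1 * (1 + (1 / (12 * (n : ℝ) ^ 2) + 1 / (1440 * (n : ℝ) ^ 4))) by field,
    Real.log_mul hn0.ne' hbn.ne', Real.log_mul (x := n / Real.exp 1) (by positivity) (by positivity),
    Real.log_mul two_ne_zero hn0.ne', Real.log_sqrt (by positivity), Real.log_sqrt (by positivity),
    Real.log_mul two_ne_zero (by positivity)]
  simp only [Function.comp_apply]
  generalize Real.log (1 + b / (n : ℝ) ^ 5) = B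
  generalize Real.log (1 + (1 / (12 * (n : ℝ) ^ 2) + 1 / (1440 * (n : ℝ) ^ 4))) = U
  generalize Real.log ((n : ℝ) / Real.exp 1) = V
  field_simp
  ring
end
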